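/- arXiv:1401.4689 — 2 statements merged into one kernel-verified Lean document; each statement's English description precedes it below -/
import Mathlib

section
/- Let S = {a, a', b, b'} be a four-letter alphabet with the complementation a ↦ a', b ↦ b', and let V, W ⊆ S^d be disjoint equivalent polybox codes without twin pairs with |V| = 12. Then there is no i ∈ {1,…,d} with |V^{i,a}| = 5, |V^{i,a'}| = 1, |V^{i,b}| = 5 and |V^{i,b'}| = 1. -/
variable {S : Type}

/-- Two words are dichotomous: at some position they carry complementary letters. -/
def Dicho {d : ℕ} (c : S → S) (u v : Fin d → S) : Prop := ∃ j, v j = c (u j)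

/-- Two words form a twin pair. -/
def TwinPair {d : ℕ} (c : S → S) (u v : Fin d → S) : Prop :=
  ∃ j, v j = c (u j) ∧ ∀ i, i ≠ j → v i = u i

/-- A polybox code: a set of pairwise dichotomous words. -/
def PolyboxCode {d : ℕ} (c : S → S) (V : Set (Fin d → S)) : Prop :=
  ∀ u ∈ V, ∀ v ∈ V, u ≠ v → Dicho c u v

/-- The code contains no twin pair. -/
def NoTwinPair {d : ℕ} (c : S → S) (V : Set (Fin d → S)) : Prop :=
  ∀ u ∈ V, ∀ v ∈ V, ¬ TwinPair c u v

/-- `ES`: sets containing exactly one of `s`, `s'` for every letter `s`. -/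
def ESet (c : S → S) : Set (Set S) := {B | ∀ s, Xor' (s ∈ B) (c s ∈ B)}

/-- `Es`: members of `ES` containing the letter `s`. -/
def ELetter (c : S → S) (s : S) : Set (Set S) := {B | B ∈ ESet c ∧ s ∈ B}

/-- The equicomplementary realization `v̌ ⊆ (ES)^d` of a word `v`. -/
def Realize {d : ℕ} (c : S → S) (v : Fin d → S) : Set (Fin d → Set S) :=
  {x | ∀ i, x i ∈ ELetter c (v i)}

/-- The union `⋃_{v ∈ V} v̌`. -/
def RealizeSet {d : ℕ} (c : S → S) (V : Set (Fin d → S)) : Set (Fin d → Set S) :=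
  ⋃ v ∈ V, Realize c v

/-- Two codes are equivalent if their realizations coincide. -/
def EquivCodes {d : ℕ} (c : S → S) (V W : Set (Fin d → S)) : Prop :=
  RealizeSet c V = RealizeSet c W

/-- A partition code: a polybox code whose realization is the whole box `(ES)^d`. -/
def PartitionCode {d : ℕ} (c : S → S) (U : Set (Fin d → S)) : Prop :=
  PolyboxCode c U ∧ RealizeSet c U = {x | ∀ i, x i ∈ ESet c}

/-- `V^{i,l}`: the words of `V` with letter `l` at position `i`. -/
def Subcode {d : ℕ} (V : Set (Fin d → S)) (i : Fin d) (l : S) : Set (Fin d → S) :=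
  {v | v ∈ V ∧ v i = l}

namespace Polybox

open Function

/-- The four letters: the first component is the type of the letter, the second its sign. -/
abbrev Letter := Bool × Bool

/-- The complementary letter. -/
def flip (l : Letter) : Letter := (l.1, !l.2)

/-- The point `z`, listing the sign chosen for each type, belongs to the letter `l`. -/
def Has (z l : Letter) : Prop := (bif l.1 then z.2 else z.1) = l.2

instance (z l : Letter) : Decidable (Has z l) := inferInstanceAs (Decidable (_ = _))

lemma flip_flip (l : Letter) : flip (flip l) = l := by revert l; decide

lemma ne_flip (l : Letter) : l ≠ flip l := by revert l; decide

lemma has_flip (z l : Letter) : Has z (flip l) ↔ ¬ Has z l := by revert z l; decide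

lemma exists_has_has {l m : Letter} (h : m ≠ flip l) : ∃ z, Has z l ∧ Has z m := by
  revert l m; decide

lemma exists_has_not_has {l m : Letter} (h : l ≠ m) : ∃ z, Has z l ∧ ¬ Has z m := by
  revert l m; decide

set_option synthInstance.maxSize 1000 in
lemma exists_has_has_not_has {l m n : Letter} (hm : m ≠ flip l) (hn : n ≠ flip l) (hmn : m ≠ n)
    (hnl : n ≠ l) : ∃ z, Has z l ∧ Has z m ∧ ¬ Has z n := by
  revert l m n; decide

lemma exists_letter_of_has {z l : Letter} (h : Has z l) :
    ∃ m, Has z m ∧ m ≠ l ∧ m ≠ flip l := by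
  revert z l; decide

lemma letter_cases {l m : Letter} (h : m ≠ l) (h' : m ≠ flip l) (n : Letter) :
    n = l ∨ n = flip l ∨ n = m ∨ n = flip m := by
  revert l m n; decide

lemma exists_other (l : Letter) : ∃ m, m ≠ l ∧ m ≠ flip l := by revert l; decide

lemma eq_flip_of_cover {l m n : Letter} (hlm : l ≠ m) (hln : l ≠ n)
    (h : ∀ z, Has z l → Has z m ∨ Has z n) : n = flip m := by
  revert l m n; decide

variable {d : ℕ}

/-- The point `x` lies in the box of the word `w`. -/
def Mem (x w : Fin d → Letter) : Prop := ∀ i, Has (x i) (w i)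

instance (x w : Fin d → Letter) : Decidable (Mem x w) := inferInstanceAs (Decidable (∀ _, _))

lemma mem_update_point {x w : Fin d → Letter} {i : Fin d} {z : Letter} :
    Mem (update x i z) w ↔ Has z (w i) ∧ ∀ j ≠ i, Has (x j) (w j) := by
  constructor
  · intro h
    refine ⟨by simpa using h i, fun j hj => by simpa [hj] using h j⟩
  · rintro ⟨h, h'⟩ j
    by_cases hj : j = i
    · subst hj; simpa using h
    · simpa [hj] using h' j hj

lemma mem_update_word {x w : Fin d → Letter} {i : Fin d} {l : Letter} :
    Mem x (update w i l) ↔ Has (x i) l ∧ ∀ j ≠ i, Has (x j) (w j) := by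
  constructor
  · intro h
    refine ⟨by simpa using h i, fun j hj => by simpa [hj] using h j⟩
  · rintro ⟨h, h'⟩ j
    by_cases hj : j = i
    · subst hj; simpa using h
    · simpa [hj] using h' j hj

lemma dicho_symm {u v : Fin d → Letter} (h : Dicho flip u v) : Dicho flip v u := by
  obtain ⟨j, hj⟩ := h
  exact ⟨j, by rw [hj, flip_flip]⟩

lemma not_dicho_of_mem {x u v : Fin d → Letter} (hu : Mem x u) (hv : Mem x v) :
    ¬ Dicho flip u v := by
  rintro ⟨j, hj⟩
  have := hv j
  rw [hj, has_flip] at this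
  exact this (hu j)

lemma exists_mem_mem {u v : Fin d → Letter} (h : ¬ Dicho flip u v) : ∃ x, Mem x u ∧ Mem x v := by
  have h' : ∀ j, ∃ z, Has z (u j) ∧ Has z (v j) := fun j =>
    exists_has_has fun e => h ⟨j, e⟩
  choose x hx using h'
  exact ⟨x, fun i => (hx i).1, fun i => (hx i).2⟩

lemma not_dicho_self (u : Fin d → Letter) : ¬ Dicho flip u u := by
  rintro ⟨j, hj⟩
  exact ne_flip _ hj

lemma exists_mem (u : Fin d → Letter) : ∃ x, Mem x u :=
  (exists_mem_mem (not_dicho_self u)).imp fun _ h => h.1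

lemma eq_of_subset {u v : Fin d → Letter} (h : ∀ x, Mem x u → Mem x v) : u = v := by
  by_contra hne
  obtain ⟨i, hi⟩ := Function.ne_iff.1 hne
  obtain ⟨z, hz, hz'⟩ := exists_has_not_has hi
  obtain ⟨x, hx⟩ := exists_mem u
  exact hz' (mem_update_point.1 (h (update x i z) (mem_update_point.2 ⟨hz, fun j _ => hx j⟩))).1

lemma eq_of_mem {P : Set (Fin d → Letter)} (hP : PolyboxCode flip P) {u v x : Fin d → Letter}
    (hu : u ∈ P) (hv : v ∈ P) (hxu : Mem x u) (hxv : Mem x v) : u = v := by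
  by_contra h
  exact not_dicho_of_mem hxu hxv (hP u hu v hv h)

/-- The words of `P` with letter `l` at position `i`, that letter being replaced by `m`. -/
def hat (P : Finset (Fin d → Letter)) (i : Fin d) (l m : Letter) : Finset (Fin d → Letter) :=
  (P.filter (· i = l)).image (update · i m)

lemma mem_hat {P : Finset (Fin d → Letter)} {i : Fin d} {l m : Letter} {w : Fin d → Letter} :
    w ∈ hat P i l m ↔ ∃ v ∈ P, v i = l ∧ update v i m = w := by
  simp [hat, and_assoc]

lemma eq_of_update_eq {u v : Fin d → Letter} {i : Fin d} {m : Letter} (h : u i = v i)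
    (h' : update u i m = update v i m) : u = v := by
  funext j
  by_cases hj : j = i
  · subst hj; exact h
  · simpa [hj] using congrFun h' j

lemma injOn_update (P : Finset (Fin d → Letter)) (i : Fin d) (l m : Letter) :
    Set.InjOn (update · i m) (↑(P.filter (· i = l)) : Set (Fin d → Letter)) := by
  intro u hu v hv h
  simp only [Finset.coe_filter, Set.mem_ofPred_eq] at hu hv
  exact eq_of_update_eq (hu.2.trans hv.2.symm) h

lemma card_hat (P : Finset (Fin d → Letter)) (i : Fin d) (l m : Letter) :
    (hat P i l m).card = (P.filter (· i = l)).card :=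
  Finset.card_image_of_injOn (injOn_update P i l m)

lemma dicho_update {u v : Fin d → Letter} {i : Fin d} (m n : Letter) (h : Dicho flip u v)
    (hi : v i ≠ flip (u i)) : Dicho flip (update u i m) (update v i n) := by
  obtain ⟨j, hj⟩ := h
  have : j ≠ i := by rintro rfl; exact hi hj
  exact ⟨j, by simpa [this] using hj⟩

lemma polyboxCode_hat {P : Finset (Fin d → Letter)} (hP : PolyboxCode flip (P : Set (Fin d → Letter)))
    (i : Fin d) (l m : Letter) : PolyboxCode flip (hat P i l m : Set (Fin d → Letter)) := by
  intro _ hu' _ hv' huv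
  obtain ⟨u, hu, hul, rfl⟩ := mem_hat.1 hu'
  obtain ⟨v, hv, hvl, rfl⟩ := mem_hat.1 hv'
  refine dicho_update m m (hP u hu v hv ?_) ?_
  · rintro rfl; exact huv rfl
  · rw [hul, hvl]; exact ne_flip l

lemma noTwinPair_hat {P : Finset (Fin d → Letter)} (hP : NoTwinPair flip (P : Set (Fin d → Letter)))
    (i : Fin d) (l m : Letter) : NoTwinPair flip (hat P i l m : Set (Fin d → Letter)) := by
  rintro _ hu' _ hv' ⟨j, hj, h⟩
  obtain ⟨u, hu, hul, rfl⟩ := mem_hat.1 hu'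
  obtain ⟨v, hv, hvl, rfl⟩ := mem_hat.1 hv'
  have hji : j ≠ i := by
    rintro rfl
    simp only [update_self] at hj
    exact ne_flip m hj
  refine hP u hu v hv ⟨j, by simpa [hji] using hj, fun k hk => ?_⟩
  by_cases hki : k = i
  · rw [hki, hul, hvl]
  · simpa [hki] using h k hk

lemma twinPair_of_update_eq {u v : Fin d → Letter} {i : Fin d} {m : Letter}
    (hi : v i = flip (u i)) (h : update u i m = update v i m) : TwinPair flip u v := by
  refine ⟨i, hi, fun j hj => ?_⟩
  simpa [hj] using (congrFun h j).symm

/-- Inside the box `p`, a box `q` partitioned by at most four boxes, no two of which form a twin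
pair, is one of them. -/
theorem mem_of_partition (p : Fin d → Letter) (U : Finset (Fin d → Letter)) (q : Fin d → Letter)
    (hcard : U.card ≤ 4) (hU : PolyboxCode flip (U : Set (Fin d → Letter))) (hUt : NoTwinPair flip (U : Set (Fin d → Letter)))
    (hpU : ∀ u ∈ U, ¬ Dicho flip p u) (hpq : ¬ Dicho flip p q)
    (hq : ∀ x, Mem x p → (Mem x q ↔ ∃ u ∈ U, Mem x u)) : q ∈ U := by
  induction h : U.card using Nat.strong_induction_on generalizing U q with
  | _ n ih =>
  subst h
  obtain ⟨x₀, hx₀p, hx₀q⟩ := exists_mem_mem hpq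
  obtain ⟨u, hu, -⟩ := (hq x₀ hx₀p).1 hx₀q
  by_contra hqU
  obtain ⟨i, hi⟩ := Function.ne_iff.1 (show u ≠ q by rintro rfl; exact hqU hu)
  have hup : ∀ v ∈ U, ∀ j, v j ≠ flip (p j) := fun v hv j e => hpU v hv ⟨j, e⟩
  have hqi : q i = p i := by
    by_contra hqp
    obtain ⟨z, hzp, hzu, hzq⟩ := exists_has_has_not_has (hup u hu i)
      (fun e => hpq ⟨i, e⟩) hi hqp
    obtain ⟨x, hxp, hxu⟩ := exists_mem_mem (hpU u hu)
    have := (hq (update x i z) (mem_update_point.2 ⟨hzp, fun j _ => hxp j⟩)).2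
      ⟨u, hu, mem_update_point.2 ⟨hzu, fun j _ => hxu j⟩⟩
    exact hzq (mem_update_point.1 this).1
  have cross : ∀ l, l ≠ p i → l ≠ flip (p i) → ∀ x, Mem x p → ∀ u ∈ U, u i = l →
      Mem x (update u i (p i)) → ∃ v ∈ U, v i = flip l ∧ Mem x (update v i (p i)) := by
    intro l hlp hlp' x hxp u hu hul hxu
    rw [mem_update_word] at hxu
    obtain ⟨z, hzp, hzl⟩ := exists_has_has hlp'
    obtain ⟨z', hzp', hzl'⟩ := exists_has_has (l := p i) (m := flip l)
      (by intro e; exact hlp (by rw [← flip_flip l, e, flip_flip]))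
    have h1q := (hq (update x i z) (mem_update_point.2 ⟨hzp, fun j _ => hxp j⟩)).2
      ⟨u, hu, mem_update_point.2 ⟨hul ▸ hzl, hxu.2⟩⟩
    rw [mem_update_point] at h1q
    obtain ⟨v, hv, hxv⟩ := (hq (update x i z') (mem_update_point.2 ⟨hzp', fun j _ => hxp j⟩)).1
      (mem_update_point.2 ⟨hqi ▸ hzp', h1q.2⟩)
    rw [mem_update_point] at hxv
    refine ⟨v, hv, ?_, mem_update_word.2 ⟨hxp i, hxv.2⟩⟩
    rcases letter_cases hlp hlp' (v i) with e | e | e | e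
    · have huv : u = v := eq_of_mem hU hu hv (x := update x i z)
        (mem_update_point.2 ⟨hul ▸ hzl, hxu.2⟩) (mem_update_point.2 ⟨e ▸ hzp, hxv.2⟩)
      exact absurd (by rw [← hul, huv, e]) hlp
    · exact absurd e (hup v hv i)
    · exact absurd (e ▸ hxv.1) ((has_flip _ _).1 hzl')
    · exact e
  have single : ∀ l, l ≠ p i → l ≠ flip (p i) → (U.filter (· i = l)).card ≠ 1 := by
    intro l hlp hlp' h1
    obtain ⟨u, hA⟩ := Finset.card_eq_one.1 h1
    have huA : u ∈ U.filter (· i = l) := by simp [hA]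
    have hu : u ∈ U := (Finset.mem_filter.1 huA).1
    have hul : u i = l := (Finset.mem_filter.1 huA).2
    have hfl : flip l ≠ p i := by rintro e; exact hlp' (by rw [← e, flip_flip])
    have hfl' : flip l ≠ flip (p i) := by
      intro e; exact hlp (by rw [← flip_flip l, e, flip_flip])
    have hlt : (hat U i (flip l) (p i)).card < U.card := by
      rw [card_hat]
      refine Finset.card_lt_card (Finset.filter_ssubset.2 ⟨u, hu, ?_⟩)
      rw [hul]; exact ne_flip l
    have hmem : update u i (p i) ∈ hat U i (flip l) (p i) := by
      refine ih _ hlt _ _ (by omega) (polyboxCode_hat hU _ _ _) (noTwinPair_hat hUt _ _ _)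
        ?_ ?_ ?_ rfl
      · intro _ hv'
        obtain ⟨v, hv, -, rfl⟩ := mem_hat.1 hv'
        rintro ⟨j, hj⟩
        by_cases hji : j = i
        · subst hji; simp only [update_self] at hj; exact ne_flip _ hj
        · exact hup v hv j (by simpa [hji] using hj)
      · rintro ⟨j, hj⟩
        by_cases hji : j = i
        · subst hji; simp only [update_self] at hj; exact ne_flip _ hj
        · exact hup u hu j (by simpa [hji] using hj)
      · intro x hxp
        constructor
        · intro hx
          obtain ⟨v, hv, hvl, hxv⟩ := cross l hlp hlp' x hxp u hu hul hx
          exact ⟨_, mem_hat.2 ⟨v, hv, hvl, rfl⟩, hxv⟩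
        · rintro ⟨_, hv', hxv⟩
          obtain ⟨v, hv, hvl, rfl⟩ := mem_hat.1 hv'
          obtain ⟨w, hw, hwl, hxw⟩ := cross _ hfl hfl' x hxp v hv hvl hxv
          have : w ∈ U.filter (· i = l) := Finset.mem_filter.2 ⟨hw, by rw [hwl, flip_flip]⟩
          rw [hA, Finset.mem_singleton] at this
          rwa [← this]
    obtain ⟨v, hv, hvl, he⟩ := mem_hat.1 hmem
    exact hUt u hu v hv (twinPair_of_update_eq (by rw [hul, hvl]) he.symm)
  set l := u i with hl
  have hlp : l ≠ p i := by rw [← hqi]; exact hi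
  have hlp' : l ≠ flip (p i) := hup u hu i
  have hfl : flip l ≠ p i := by rintro e; exact hlp' (by rw [← e, flip_flip])
  have hfl' : flip l ≠ flip (p i) := by
    intro e; exact hlp (by rw [← flip_flip l, e, flip_flip])
  have hA : 0 < (U.filter (· i = l)).card := Finset.card_pos.2 ⟨u, by simp [hu, hl]⟩
  have hB : 0 < (U.filter (· i = flip l)).card := by
    obtain ⟨x, hxp, hxu⟩ := exists_mem_mem (hpU u hu)
    obtain ⟨v, hv, hvl, -⟩ := cross l hlp hlp' x hxp u hu rfl
      (mem_update_word.2 ⟨hxp i, fun j _ => hxu j⟩)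
    exact Finset.card_pos.2 ⟨v, by simp [hv, hvl]⟩
  have hA1 := single l hlp hlp'
  have hB1 := single _ hfl hfl'
  have hdisj : Disjoint (U.filter (· i = l)) (U.filter (· i = flip l)) := by
    rw [Finset.disjoint_filter]
    intro w _ h1 h2
    exact ne_flip l (h1.symm.trans h2)
  have hsub : U.filter (· i = l) ∪ U.filter (· i = flip l) ⊆ U :=
    Finset.union_subset (Finset.filter_subset _ _) (Finset.filter_subset _ _)
  have hsum := Finset.card_union_of_disjoint hdisj
  have hle := Finset.card_le_card hsub
  have hall : U.filter (· i = l) ∪ U.filter (· i = flip l) = U :=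
    Finset.eq_of_subset_of_card_le hsub (by omega)
  obtain ⟨z, hzp, hzl⟩ := exists_has_has hlp'
  have hqA : ∀ w ∈ U, w i = l → ∀ x, Mem x p → Mem x (update w i (p i)) → Mem x q := by
    intro w hw hwl x hxp hxw
    rw [mem_update_word] at hxw
    have := (hq (update x i z) (mem_update_point.2 ⟨hzp, fun j _ => hxp j⟩)).2
      ⟨w, hw, mem_update_point.2 ⟨hwl ▸ hzl, hxw.2⟩⟩
    rw [mem_update_point] at this
    intro j
    by_cases hj : j = i
    · rw [hj, hqi]; exact hxp i
    · exact this.2 j hj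
  have hmem : q ∈ hat U i l (p i) := by
    refine ih _ (by rw [card_hat]; omega) _ _ (by rw [card_hat]; omega) (polyboxCode_hat hU _ _ _)
      (noTwinPair_hat hUt _ _ _) ?_ hpq ?_ rfl
    · intro _ hv'
      obtain ⟨v, hv, -, rfl⟩ := mem_hat.1 hv'
      rintro ⟨j, hj⟩
      by_cases hji : j = i
      · subst hji; simp only [update_self] at hj; exact ne_flip _ hj
      · exact hup v hv j (by simpa [hji] using hj)
    · intro x hxp
      constructor
      · intro hxq
        obtain ⟨v, hv, hxv⟩ := (hq x hxp).1 hxq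
        have hxv' : Mem x (update v i (p i)) := mem_update_word.2 ⟨hxp i, fun j _ => hxv j⟩
        have hv' := hv
        rw [← hall, Finset.mem_union, Finset.mem_filter, Finset.mem_filter] at hv'
        rcases hv' with ⟨-, e⟩ | ⟨-, e⟩
        · exact ⟨_, mem_hat.2 ⟨v, hv, e, rfl⟩, hxv'⟩
        · obtain ⟨w, hw, hwl, hxw⟩ := cross _ hfl hfl' x hxp v hv e hxv'
          exact ⟨_, mem_hat.2 ⟨w, hw, by rw [hwl, flip_flip], rfl⟩, hxw⟩
      · rintro ⟨_, hv', hxv⟩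
        obtain ⟨v, hv, hvl, rfl⟩ := mem_hat.1 hv'
        exact hqA v hv hvl x hxp hxv
  obtain ⟨v, hv, hvl, hvq⟩ := mem_hat.1 hmem
  obtain ⟨w, hw, hwv⟩ := Finset.exists_mem_ne (s := U.filter (· i = l)) (by omega) v
  obtain ⟨hw, hwl⟩ := Finset.mem_filter.1 hw
  obtain ⟨x, hxp, hxw⟩ := exists_mem_mem (hpU w hw)
  have hxq := hqA w hw hwl x hxp (mem_update_word.2 ⟨hxp i, fun j _ => hxw j⟩)
  rw [← hvq, mem_update_word] at hxq
  refine hwv (eq_of_mem hU hw hv hxw fun j => ?_)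
  by_cases hj : j = i
  · rw [hj, hvl, ← hwl]; exact hxw i
  · exact hxq.2 j hj

/-- A code without twin pairs covering a word outside it has at least five words meeting it. -/
theorem five_le_card_of_cover {P : Finset (Fin d → Letter)} {p : Fin d → Letter}
    (hP : PolyboxCode flip (P : Set (Fin d → Letter))) (hPt : NoTwinPair flip (P : Set (Fin d → Letter)))
    (hcov : ∀ x, Mem x p → ∃ v ∈ P, Mem x v) (hp : p ∉ P) :
    ∃ Q ⊆ P, 5 ≤ Q.card ∧ ∀ v ∈ Q, ¬ Dicho flip p v := by
  classical
  refine ⟨P.filter (¬ Dicho flip p ·), Finset.filter_subset _ _, ?_, fun v hv =>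
    (Finset.mem_filter.1 hv).2⟩
  by_contra hlt
  refine hp (Finset.mem_filter.1 (mem_of_partition p (P.filter (¬ Dicho flip p ·)) p (by omega)
    (fun u hu v hv => hP u ?_ v ?_) (fun u hu v hv => hPt u ?_ v ?_)
    (fun v hv => (Finset.mem_filter.1 hv).2) (not_dicho_self p) ?_)).1
  · exact (Finset.mem_filter.1 hu).1
  · exact (Finset.mem_filter.1 hv).1
  · exact (Finset.mem_filter.1 hu).1
  · exact (Finset.mem_filter.1 hv).1
  · intro x hx
    refine ⟨fun _ => ?_, fun _ => hx⟩
    obtain ⟨v, hv, hxv⟩ := hcov x hx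
    exact ⟨v, Finset.mem_filter.2 ⟨hv, not_dicho_of_mem hx hxv⟩, hxv⟩

lemma mem_of_cover {P : Finset (Fin d → Letter)} {p : Fin d → Letter}
    (hP : PolyboxCode flip (P : Set (Fin d → Letter))) (hPt : NoTwinPair flip (P : Set (Fin d → Letter)))
    (hcov : ∀ x, Mem x p → ∃ v ∈ P, Mem x v) (hcard : P.card ≤ 4) : p ∈ P := by
  by_contra hp
  obtain ⟨Q, hQ, h5, -⟩ := five_le_card_of_cover hP hPt hcov hp
  have := Finset.card_le_card hQ
  omega

lemma not_dicho_of_cover {P : Finset (Fin d → Letter)} {p : Fin d → Letter}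
    (hP : PolyboxCode flip (P : Set (Fin d → Letter))) (hPt : NoTwinPair flip (P : Set (Fin d → Letter)))
    (hcov : ∀ x, Mem x p → ∃ v ∈ P, Mem x v) (hp : p ∉ P) (hcard : P.card ≤ 5) :
    ∀ v ∈ P, ¬ Dicho flip p v := by
  obtain ⟨Q, hQ, h5, h⟩ := five_le_card_of_cover hP hPt hcov hp
  rwa [Finset.eq_of_subset_of_card_le hQ (by omega)] at h

/-- The indicator function of the box of `w`. -/
def ind (w x : Fin d → Letter) : ℤ := if Mem x w then 1 else 0

/-- The number of words of `P` whose boxes contain the point `x`. -/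
def cnt (P : Finset (Fin d → Letter)) (x : Fin d → Letter) : ℤ := ∑ v ∈ P, ind v x

lemma ind_of_mem {w x : Fin d → Letter} (h : Mem x w) : ind w x = 1 := if_pos h

lemma ind_of_not_mem {w x : Fin d → Letter} (h : ¬ Mem x w) : ind w x = 0 := if_neg h

lemma ind_nonneg (w x : Fin d → Letter) : 0 ≤ ind w x := by
  unfold ind; split_ifs <;> simp

lemma mem_of_ind_pos {w x : Fin d → Letter} (h : 0 < ind w x) : Mem x w := by
  by_contra h'
  rw [ind_of_not_mem h'] at h
  exact h.false

lemma ind_congr {u v x y : Fin d → Letter} (h : Mem x u ↔ Mem y v) : ind u x = ind v y := by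
  simp [ind, h]

lemma cnt_singleton (w x : Fin d → Letter) : cnt {w} x = ind w x := by simp [cnt]

lemma cnt_nonneg (P : Finset (Fin d → Letter)) (x : Fin d → Letter) : 0 ≤ cnt P x :=
  Finset.sum_nonneg fun _ _ => ind_nonneg _ _

lemma cnt_eq_zero {P : Finset (Fin d → Letter)} {x : Fin d → Letter}
    (h : ∀ v ∈ P, ¬ Mem x v) : cnt P x = 0 :=
  Finset.sum_eq_zero fun v hv => ind_of_not_mem (h v hv)

lemma exists_of_cnt_pos {P : Finset (Fin d → Letter)} {x : Fin d → Letter}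
    (h : 0 < cnt P x) : ∃ v ∈ P, Mem x v := by
  by_contra! h'
  rw [cnt_eq_zero h'] at h
  exact h.false

lemma cnt_eq_one {P : Finset (Fin d → Letter)} {v x : Fin d → Letter}
    (hP : PolyboxCode flip (P : Set (Fin d → Letter))) (hv : v ∈ P) (hx : Mem x v) :
    cnt P x = 1 := by
  rw [cnt, Finset.sum_eq_single_of_mem v hv, ind_of_mem hx]
  intro u hu huv
  exact ind_of_not_mem fun hxu => huv (eq_of_mem hP hu hv hxu hx)

lemma sum_ind (w : Fin d → Letter) : ∑ x, ind w x = 2 ^ d := by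
  have h1 : ∀ x, ind w x = ∏ i, if Has (x i) (w i) then (1 : ℤ) else 0 := by
    intro x
    by_cases h : Mem x w
    · rw [ind_of_mem h, Finset.prod_eq_one fun i _ => if_pos (h i)]
    · obtain ⟨i, hi⟩ := not_forall.1 h
      rw [ind_of_not_mem h, Finset.prod_eq_zero (Finset.mem_univ i) (if_neg hi)]
  have h2 : ∀ l : Letter, ∑ z : Letter, (if Has z l then (1 : ℤ) else 0) = 2 := by decide
  have h3 := Finset.prod_univ_sum (fun _ : Fin d => (Finset.univ : Finset Letter))
    (fun i z => if Has z (w i) then (1 : ℤ) else 0)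
  simp only [h2, Finset.prod_const, Finset.card_univ, Fintype.card_fin,
    Fintype.piFinset_univ] at h3
  rw [h3]
  exact Finset.sum_congr rfl fun x _ => h1 x

lemma card_add_card_eq {P Q R T : Finset (Fin d → Letter)}
    (h : ∀ x, cnt P x + cnt Q x = cnt R x + cnt T x) :
    P.card + Q.card = R.card + T.card := by
  have hs : ∀ P : Finset (Fin d → Letter), ∑ x, cnt P x = P.card * 2 ^ d := by
    intro P
    simp only [cnt]
    rw [Finset.sum_comm]
    simp [sum_ind]
  have h' := Finset.sum_congr (rfl : (Finset.univ : Finset (Fin d → Letter)) = _) fun x _ => h x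
  simp only [Finset.sum_add_distrib, hs, ← add_mul] at h'
  exact_mod_cast mul_right_cancel₀ (by positivity) h'

set_option synthInstance.maxSize 1000 in
lemma letter_eq_or_of_has {z l m n : Letter} (hl : Has z l) (hm : Has z m) (hlm : l ≠ m)
    (hn : Has z n) : n = l ∨ n = m := by
  revert z l m n; decide

lemma cnt_eq_add (P : Finset (Fin d → Letter)) {x : Fin d → Letter} {i : Fin d} {l m : Letter}
    (hl : Has (x i) l) (hm : Has (x i) m) (hlm : l ≠ m) :
    cnt P x = cnt (P.filter (· i = l)) x + cnt (P.filter (· i = m)) x := by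
  simp only [cnt, Finset.sum_filter, ← Finset.sum_add_distrib]
  refine Finset.sum_congr rfl fun v _ => ?_
  by_cases hv : Mem x v
  · rcases letter_eq_or_of_has hl hm hlm (hv i) with e | e
    · simp [e, hlm]
    · simp [e, hlm.symm]
  · simp [ind_of_not_mem hv]

lemma cnt_filter_update (P : Finset (Fin d → Letter)) {x : Fin d → Letter} {i : Fin d}
    {z l : Letter} (hl : Has (x i) l) (hz : Has z l) :
    cnt (P.filter (· i = l)) (update x i z) = cnt (P.filter (· i = l)) x := by
  refine Finset.sum_congr rfl fun v hv => ind_congr ?_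
  have hv := (Finset.mem_filter.1 hv).2
  rw [mem_update_point, hv]
  refine ⟨fun h j => ?_, fun h => ⟨hz, fun j _ => h j⟩⟩
  by_cases hj : j = i
  · rw [hj, hv]; exact hl
  · exact h.2 j hj

lemma cnt_hat (P : Finset (Fin d → Letter)) {x : Fin d → Letter} {i : Fin d}
    {z l m : Letter} (hm : Has (x i) m) (hz : Has z l) :
    cnt (hat P i l m) x = cnt (P.filter (· i = l)) (update x i z) := by
  rw [cnt, hat, Finset.sum_image (injOn_update P i l m)]
  refine Finset.sum_congr rfl fun v hv => ind_congr ?_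
  have hv := (Finset.mem_filter.1 hv).2
  rw [mem_update_point, mem_update_word, hv]
  simp [hm, hz]

lemma cnt_hat_eq_zero (P : Finset (Fin d → Letter)) {x : Fin d → Letter} {i : Fin d}
    (l : Letter) {m : Letter} (hm : ¬ Has (x i) m) : cnt (hat P i l m) x = 0 := by
  refine cnt_eq_zero fun v hv hx => ?_
  obtain ⟨v, -, -, rfl⟩ := mem_hat.1 hv
  exact hm (mem_update_word.1 hx).1

/-- In a small code without twin pairs covering an outside word `p`, every letter of `p` occurs at
its position. -/
lemma exists_apply_eq_of_cover {P : Finset (Fin d → Letter)} {p : Fin d → Letter}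
    (hP : PolyboxCode flip (P : Set (Fin d → Letter)))
    (hPt : NoTwinPair flip (P : Set (Fin d → Letter)))
    (hcov : ∀ x, Mem x p → ∃ v ∈ P, Mem x v) (hp : p ∉ P) (hcard : P.card ≤ 5) (k : Fin d) :
    ∃ v ∈ P, v k = p k := by
  by_contra! hk
  have hmeet := not_dicho_of_cover hP hPt hcov hp hcard
  obtain ⟨m, hm, hm'⟩ := exists_other (p k)
  have hcov' : ∀ n, n ≠ p k → n ≠ flip (p k) → ∀ x, Mem x p →
      ∃ v ∈ hat P k n (p k), Mem x v := by
    intro n hn hn' x hx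
    obtain ⟨z, hzp, hzn⟩ := exists_has_has hn'
    obtain ⟨v, hv, hxv⟩ := hcov (update x k z) (mem_update_point.2 ⟨hzp, fun j _ => hx j⟩)
    rw [mem_update_point] at hxv
    refine ⟨_, mem_hat.2 ⟨v, hv, ?_, rfl⟩, mem_update_word.2 ⟨hx k, hxv.2⟩⟩
    rcases letter_eq_or_of_has hzp hzn hn.symm hxv.1 with e | e
    · exact absurd e (hk v hv)
    · exact e
  have hfm : flip m ≠ p k := by rintro e; exact hm' (by rw [← e, flip_flip])
  have hfm' : flip m ≠ flip (p k) := by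
    intro e; exact hm (by rw [← flip_flip m, e, flip_flip])
  have hpos : ∀ n, n ≠ p k → n ≠ flip (p k) → 0 < (hat P k n (p k)).card := by
    intro n hn hn'
    obtain ⟨x, hx⟩ := exists_mem p
    obtain ⟨v, hv, -⟩ := hcov' n hn hn' x hx
    exact Finset.card_pos.2 ⟨v, hv⟩
  have hsum : (hat P k m (p k)).card + (hat P k (flip m) (p k)).card ≤ P.card := by
    rw [card_hat, card_hat, ← Finset.card_union_of_disjoint]
    · exact Finset.card_le_card
        (Finset.union_subset (Finset.filter_subset _ _) (Finset.filter_subset _ _))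
    · rw [Finset.disjoint_filter]
      intro w _ h1 h2
      exact ne_flip m (h1.symm.trans h2)
  have h1 := hpos m hm hm'
  have h2 := hpos _ hfm hfm'
  obtain ⟨u, hu, hum, hup⟩ := mem_hat.1 (mem_of_cover (polyboxCode_hat hP k m (p k))
    (noTwinPair_hat hPt _ _ _) (hcov' m hm hm') (by omega))
  obtain ⟨v, hv, hvm, hvp⟩ := mem_hat.1 (mem_of_cover (polyboxCode_hat hP k (flip m) (p k))
    (noTwinPair_hat hPt _ _ _) (hcov' _ hfm hfm') (by omega))
  exact hPt u hu v hv (twinPair_of_update_eq (by rw [hum, hvm]) (hup.trans hvp.symm))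

lemma update_not_mem_of_cover {P : Finset (Fin d → Letter)} {p : Fin d → Letter}
    (hP : PolyboxCode flip (P : Set (Fin d → Letter)))
    (hPt : NoTwinPair flip (P : Set (Fin d → Letter)))
    (hcov : ∀ x, Mem x p → ∃ v ∈ P, Mem x v) (hp : p ∉ P) (hcard : P.card ≤ 5) (k : Fin d)
    (l : Letter) : update p k l ∉ P := by
  intro hv
  have hmeet := not_dicho_of_cover hP hPt hcov hp hcard
  obtain ⟨u, hu, huk⟩ := exists_apply_eq_of_cover hP hPt hcov hp hcard k
  have hne : update p k l ≠ u := by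
    intro e
    apply hp
    rw [← e, update_self] at huk
    rwa [huk, update_eq_self] at hv
  obtain ⟨j, hj⟩ := hP _ hv u hu hne
  by_cases hjk : j = k
  · rw [hjk, huk, update_self] at hj
    exact hmeet _ hv ⟨k, by rw [update_self, hj, flip_flip]⟩
  · exact hmeet u hu ⟨j, by simpa [hjk] using hj⟩

/-- A box covered by two other boxes is cut by them into two halves. -/
lemma exists_of_cover_pair {p q w : Fin d → Letter} (h : ∀ x, Mem x w → Mem x p ∨ Mem x q)
    (hp : w ≠ p) (hq : w ≠ q) :
    ∃ j, q j = flip (p j) ∧ w = update p j (w j) ∧ w = update q j (w j) ∧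
      w j ≠ p j ∧ w j ≠ q j := by
  have aux : ∀ p q : Fin d → Letter, (∀ x, Mem x w → Mem x p ∨ Mem x q) → ∀ i, w i ≠ p i →
      w = update q i (w i) := by
    intro p q h i hi
    obtain ⟨z, hz, hz'⟩ := exists_has_not_has hi
    refine eq_of_subset fun x hx => mem_update_word.2 ⟨hx i, ?_⟩
    rcases h (update x i z) (mem_update_point.2 ⟨hz, fun j _ => hx j⟩) with h | h
    · exact absurd (mem_update_point.1 h).1 hz'
    · exact (mem_update_point.1 h).2
  obtain ⟨i, hi⟩ := Function.ne_iff.1 hp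
  have h1 := aux p q h i hi
  have hi' : w i ≠ q i := by
    intro e
    rw [e, update_eq_self] at h1
    exact hq h1
  refine ⟨i, eq_flip_of_cover hi hi' fun z hz => ?_,
    aux q p (fun x hx => (h x hx).symm) i hi', h1, hi, hi'⟩
  obtain ⟨x, hx⟩ := exists_mem w
  exact (h (update x i z) (mem_update_point.2 ⟨hz, fun j _ => hx j⟩)).imp
    (fun h => (mem_update_point.1 h).1) fun h => (mem_update_point.1 h).1

lemma cover_of_cnt {A C : Finset (Fin d → Letter)} {p q : Fin d → Letter} {k : Fin d}
    (hk : q k = flip (p k)) (hrel : ∀ x, cnt A x + ind q x = cnt C x + ind p x)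
    (x : Fin d → Letter) (hx : Mem x p) : ∃ v ∈ A, Mem x v := by
  refine exists_of_cnt_pos ?_
  have h1 := hrel x
  rw [ind_of_mem hx, ind_of_not_mem fun h => not_dicho_of_mem hx h ⟨k, hk⟩] at h1
  have := cnt_nonneg C x
  omega

/-- If exchanging a word `q` dichotomous to `p` for `p` turns the realization of `A` into that of
`C`, then `A` contains the twin of `q`. -/
lemma update_mem_of_exchange {A C : Finset (Fin d → Letter)} {p q : Fin d → Letter} {k : Fin d}
    (hA : PolyboxCode flip (A : Set (Fin d → Letter)))
    (hAt : NoTwinPair flip (A : Set (Fin d → Letter)))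
    (hC : PolyboxCode flip (C : Set (Fin d → Letter)))
    (hCt : NoTwinPair flip (C : Set (Fin d → Letter)))
    (hA5 : A.card ≤ 5) (hC5 : C.card ≤ 5) (hp : p ∉ A) (hq : q ∉ C) (hk : q k = flip (p k))
    (hrel : ∀ x, cnt A x + ind q x = cnt C x + ind p x) : update q k (p k) ∈ A := by
  have hk' : p k = flip (q k) := by rw [hk, flip_flip]
  have covA := cover_of_cnt hk hrel
  have covC := cover_of_cnt hk' fun x => (hrel x).symm
  have meetA := not_dicho_of_cover hA hAt covA hp hA5
  have meetC := not_dicho_of_cover hC hCt covC hq hC5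
  set l := p k
  have key : ∀ x, cnt (A.filter (· k = l)) x + cnt (hat C k (flip l) l) x =
      cnt {p} x + cnt {update q k l} x := by
    intro x
    rw [cnt_singleton, cnt_singleton]
    by_cases hxl : Has (x k) l
    · obtain ⟨m, hxm, hml, hml'⟩ := exists_letter_of_has hxl
      obtain ⟨z, hzl, hzm⟩ := exists_has_has (l := flip l) (m := m) (by rwa [flip_flip])
      have hz : Has (update x k z k) (flip l) := by simpa using hzl
      have hz' : Has (update x k z k) m := by simpa using hzm
      have e1 := hrel x
      have e2 := hrel (update x k z)
      have a1 : ∀ y, cnt (A.filter (· k = flip l)) y = 0 := fun y => cnt_eq_zero fun v hv _ =>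
        meetA v (Finset.mem_filter.1 hv).1 ⟨k, (Finset.mem_filter.1 hv).2⟩
      have c1 : ∀ y, cnt (C.filter (· k = l)) y = 0 := fun y => cnt_eq_zero fun v hv _ =>
        meetC v (Finset.mem_filter.1 hv).1 ⟨k, (Finset.mem_filter.1 hv).2.trans hk'⟩
      rw [cnt_eq_add A hxl hxm hml.symm, cnt_eq_add C hxl hxm hml.symm, c1] at e1
      rw [cnt_eq_add A hz hz' hml'.symm, cnt_eq_add C hz hz' hml'.symm, a1,
        cnt_filter_update A hxm hzm, cnt_filter_update C hxm hzm] at e2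
      have q0 : ind q x = 0 := ind_of_not_mem fun h => by
        have := h k
        rw [hk, has_flip] at this
        exact this hxl
      have p0 : ind p (update x k z) = 0 := ind_of_not_mem fun h => by
        rw [has_flip] at hz
        exact hz (h k)
      have q1 : ind q (update x k z) = ind (update q k l) x := by
        refine ind_congr ?_
        rw [mem_update_point, mem_update_word, hk]
        simp [hxl, hzl]
      rw [cnt_hat C hxl hzl]
      omega
    · rw [cnt_hat_eq_zero C _ hxl, cnt_eq_zero, ind_of_not_mem, ind_of_not_mem]
      · exact fun h => hxl (mem_update_word.1 h).1
      · exact fun h => hxl (h k)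
      · intro v hv h
        have := h k
        rw [(Finset.mem_filter.1 hv).2] at this
        exact hxl this
  have hcard := card_add_card_eq key
  rw [card_hat, Finset.card_singleton, Finset.card_singleton] at hcard
  obtain ⟨v, hv, hvk⟩ := exists_apply_eq_of_cover hA hAt covA hp hA5 k
  obtain ⟨w, hw, hwk⟩ := exists_apply_eq_of_cover hC hCt covC hq hC5 k
  have hvF : v ∈ A.filter (· k = l) := Finset.mem_filter.2 ⟨hv, hvk⟩
  by_contra hnot
  obtain ⟨j, -, hvj, -⟩ := exists_of_cover_pair (p := p) (q := update q k l) (w := v) (by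
    intro x hx
    by_contra! h
    have h1 := key x
    rw [cnt_singleton, cnt_singleton, ind_of_not_mem h.1, ind_of_not_mem h.2] at h1
    have h2 := cnt_nonneg (hat C k (flip l) l) x
    have h3 : ind v x ≤ cnt (A.filter (· k = l)) x :=
      Finset.single_le_sum (f := fun u => ind u x) (fun u _ => ind_nonneg u x) hvF
    rw [ind_of_mem hx] at h3
    omega) (by rintro rfl; exact hp hv) (by rintro rfl; exact hnot hv)
  rw [hvj] at hv
  exact update_not_mem_of_cover hA hAt covA hp hA5 j _ hv

/-- If exchanging a twin of `p` for a third parallel word turns the realization of `A` into that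
of `C`, then all words of `A` share a letter with `p`. -/
lemma apply_eq_of_twin_exchange {A C : Finset (Fin d → Letter)} {p : Fin d → Letter} {j : Fin d}
    {n : Letter} (hA : PolyboxCode flip (A : Set (Fin d → Letter)))
    (hAt : NoTwinPair flip (A : Set (Fin d → Letter))) (hA5 : A.card ≤ 5) (hp : p ∉ A)
    (hn : n ≠ p j) (hn' : n ≠ flip (p j))
    (hd : ∀ v ∈ A, Dicho flip (update p j (flip (p j))) v)
    (hrel : ∀ x, cnt A x + ind (update p j (flip (p j))) x = cnt C x + ind (update p j n) x) :
    ∀ v ∈ A, v j = p j := by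
  obtain ⟨z, hzp, hzn⟩ := exists_has_has hn'
  have hcov : ∀ x, Mem x p → ∃ v ∈ A.filter (· j = p j), Mem x v := by
    intro x hx
    have h1 := hrel (update x j z)
    rw [ind_of_mem (w := update p j n), ind_of_not_mem] at h1
    · have := cnt_nonneg C (update x j z)
      obtain ⟨v, hv, hxv⟩ := exists_of_cnt_pos (P := A) (x := update x j z) (by omega)
      rw [mem_update_point] at hxv
      have hvj : v j = p j := by
        rcases letter_eq_or_of_has hzp hzn hn.symm hxv.1 with e | e
        · exact e
        · obtain ⟨i, hi⟩ := hd v hv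
          by_cases hij : i = j
          · rw [hij, update_self, flip_flip] at hi
            exact absurd (e.symm.trans hi) hn
          · have h2 := hxv.2 i hij
            rw [hi, update_of_ne hij, has_flip] at h2
            exact absurd (hx i) h2
      refine ⟨v, Finset.mem_filter.2 ⟨hv, hvj⟩, fun i => ?_⟩
      by_cases hij : i = j
      · rw [hij, hvj]; exact hx j
      · exact hxv.2 i hij
    · intro h
      have := h j
      rw [update_self, update_self, has_flip] at this
      exact this hzp
    · rw [mem_update_word]
      refine ⟨by simpa using hzn, fun i hi => ?_⟩
      rw [update_of_ne hi]
      exact hx i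
  obtain ⟨Q, hQ, h5, -⟩ := five_le_card_of_cover (P := A.filter (· j = p j)) (p := p)
    (fun u hu v hv => hA u (Finset.mem_filter.1 hu).1 v (Finset.mem_filter.1 hv).1)
    (fun u hu v hv => hAt u (Finset.mem_filter.1 hu).1 v (Finset.mem_filter.1 hv).1)
    hcov (fun h => hp (Finset.mem_filter.1 h).1)
  have hle := Finset.card_le_card hQ
  have heq := Finset.eq_of_subset_of_card_le (Finset.filter_subset (· j = p j) A) (by omega)
  intro v hv
  rw [← heq] at hv
  exact (Finset.mem_filter.1 hv).2

lemma not_twin_exchange {A C : Finset (Fin d → Letter)} {p : Fin d → Letter} {j : Fin d}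
    {m : Letter} (hA : PolyboxCode flip (A : Set (Fin d → Letter)))
    (hAt : NoTwinPair flip (A : Set (Fin d → Letter)))
    (hC : PolyboxCode flip (C : Set (Fin d → Letter)))
    (hCt : NoTwinPair flip (C : Set (Fin d → Letter)))
    (hA5 : A.card ≤ 5) (hC5 : C.card ≤ 5) (hC0 : C.Nonempty)
    (hp : p ∉ A) (hq : update p j m ∉ C)
    (hm : m ≠ p j) (hm' : m ≠ flip (p j))
    (hdA : ∀ v ∈ A, Dicho flip (update p j (flip (p j))) v)
    (hdC : ∀ v ∈ C, Dicho flip (update p j (flip m)) v)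
    (hrel : ∀ x, cnt A x + ind (update p j (flip (p j))) x =
      cnt C x + ind (update p j (flip m)) x) : False := by
  have hfm : flip m ≠ p j := by rintro e; exact hm' (by rw [← e, flip_flip])
  have hfm' : flip m ≠ flip (p j) := by
    intro e; exact hm (by rw [← flip_flip m, e, flip_flip])
  have hAj := apply_eq_of_twin_exchange hA hAt hA5 hp hfm hfm' hdA hrel
  have hCj := apply_eq_of_twin_exchange (C := A) (p := update p j m) (j := j) (n := flip (p j))
    hC hCt hC5 hq (by rw [update_self]; exact hm'.symm) (by rw [update_self]; exact hfm'.symm)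
    (by simpa using hdC) (by simpa using fun x => (hrel x).symm)
  obtain ⟨w, hw⟩ := hC0
  have hwj := hCj w hw
  rw [update_self] at hwj
  obtain ⟨z, hzp, hzm⟩ := exists_has_has (l := flip (p j)) (m := m) (by rwa [flip_flip])
  suffices hwq : w = update p j m from hq (hwq ▸ hw)
  refine eq_of_subset fun x hx => ?_
  have hzw : Mem (update x j z) w := mem_update_point.2 ⟨hwj ▸ hzm, fun i _ => hx i⟩
  have h1 := hrel (update x j z)
  rw [cnt_eq_one hC hw hzw, cnt_eq_zero] at h1
  · have h2 := mem_of_ind_pos (w := update p j (flip (p j))) (x := update x j z) (by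
      have := ind_nonneg (update p j (flip m)) (update x j z)
      omega)
    rw [mem_update_point] at h2
    refine mem_update_word.2 ⟨hwj ▸ hx j, fun i hi => ?_⟩
    simpa [hi] using h2.2 i hi
  · intro v hv h
    have := h j
    rw [hAj v hv, update_self] at this
    exact (has_flip _ _).1 hzp this

lemma dicho_of_mem_hat {P : Finset (Fin d → Letter)}
    (hP : PolyboxCode flip (P : Set (Fin d → Letter))) {i : Fin d} {l m : Letter}
    (hlm : m ≠ l) (hlm' : m ≠ flip l) (n : Letter) {u v : Fin d → Letter}
    (hu' : u ∈ hat P i l n) (hv' : v ∈ hat P i m n) : Dicho flip u v := by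
  obtain ⟨u, hu, hul, rfl⟩ := mem_hat.1 hu'
  obtain ⟨v, hv, hvm, rfl⟩ := mem_hat.1 hv'
  refine dicho_update n n (hP u hu v hv ?_) (by rwa [hul, hvm])
  rintro rfl
  exact hlm (hvm.symm.trans hul)

lemma not_mem_hat_flip {P : Finset (Fin d → Letter)}
    (hP : NoTwinPair flip (P : Set (Fin d → Letter))) {i : Fin d} {l : Letter} (n : Letter)
    {u : Fin d → Letter} (hu' : u ∈ hat P i l n) : u ∉ hat P i (flip l) n := by
  intro hv'
  obtain ⟨u, hu, hul, rfl⟩ := mem_hat.1 hu'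
  obtain ⟨v, hv, hvm, h⟩ := mem_hat.1 hv'
  exact hP u hu v hv (twinPair_of_update_eq (by rw [hul, hvm]) h.symm)

lemma not_mem_hat_of_disjoint {P Q : Finset (Fin d → Letter)} (h : Disjoint P Q) {i : Fin d}
    {l : Letter} (n : Letter) {u : Fin d → Letter} (hu' : u ∈ hat P i l n) : u ∉ hat Q i l n := by
  intro hv'
  obtain ⟨u, hu, hul, rfl⟩ := mem_hat.1 hu'
  obtain ⟨v, hv, hvm, e⟩ := mem_hat.1 hv'
  exact Finset.disjoint_left.1 h hu (eq_of_update_eq (hul.trans hvm.symm) e.symm ▸ hv)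

lemma cnt_hat_add_cnt_hat {V W : Finset (Fin d → Letter)} (h : ∀ x, cnt V x = cnt W x)
    (i : Fin d) {l m : Letter} (n : Letter) (hlm : m ≠ l) (hlm' : m ≠ flip l)
    (x : Fin d → Letter) :
    cnt (hat V i l n) x + cnt (hat V i m n) x = cnt (hat W i l n) x + cnt (hat W i m n) x := by
  by_cases hx : Has (x i) n
  · obtain ⟨z, hzl, hzm⟩ := exists_has_has hlm'
    simp only [cnt_hat _ hx hzl, cnt_hat _ hx hzm]
    rw [← cnt_eq_add V (by simpa using hzl) (by simpa using hzm) hlm.symm,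
      ← cnt_eq_add W (by simpa using hzl) (by simpa using hzm) hlm.symm, h]
  · simp [cnt_hat_eq_zero _ _ hx]

theorem no_distribution {V W : Finset (Fin d → Letter)}
    (hV : PolyboxCode flip (V : Set (Fin d → Letter)))
    (hW : PolyboxCode flip (W : Set (Fin d → Letter))) (hdisj : Disjoint V W)
    (heq : ∀ x, cnt V x = cnt W x)
    (hVt : NoTwinPair flip (V : Set (Fin d → Letter)))
    (hWt : NoTwinPair flip (W : Set (Fin d → Letter))) (i : Fin d) {a b : Letter}
    (hba : b ≠ a) (hba' : b ≠ flip a)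
    (h1 : (V.filter (· i = a)).card = 5) (h2 : (V.filter (· i = flip a)).card = 1)
    (h3 : (V.filter (· i = b)).card = 5) (h4 : (V.filter (· i = flip b)).card = 1) : False := by
  have hfb : flip b ≠ a := by rintro rfl; exact hba' (flip_flip b).symm
  have hfb' : flip b ≠ flip a := by
    intro e; exact hba (by rw [← flip_flip b, e, flip_flip])
  have hffb : b ≠ flip (flip a) := by rwa [flip_flip]
  have hffb' : flip b ≠ flip (flip a) := by rwa [flip_flip]
  have r1 := cnt_hat_add_cnt_hat heq i a hba hba'
  have r2 := cnt_hat_add_cnt_hat heq i a hfb hfb'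
  have r3 := cnt_hat_add_cnt_hat heq i a hba' hffb
  have r4 := cnt_hat_add_cnt_hat heq i a hfb' hffb'
  have c1 := card_add_card_eq r1
  have c2 := card_add_card_eq r2
  have c3 := card_add_card_eq r3
  have c4 := card_add_card_eq r4
  rw [← card_hat V i _ a] at h1 h2 h3 h4
  have code := fun l => polyboxCode_hat hW i l a
  have notwin := fun l => noTwinPair_hat hWt i l a
  have code' := fun l => polyboxCode_hat hV i l a
  have notwin' := fun l => noTwinPair_hat hVt i l a
  obtain ⟨p, hp⟩ := Finset.card_eq_one.1 h2
  obtain ⟨p', hp'⟩ := Finset.card_eq_one.1 h4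
  have pmem : p ∈ hat V i (flip a) a := by simp [hp]
  have pmem' : p' ∈ hat V i (flip b) a := by simp [hp']
  obtain hC | hC | hC : (hat W i (flip a) a).card = 2 ∨ (hat W i (flip a) a).card = 0 ∨
    (hat W i (flip a) a).card = 1 := by omega
  · have hD : hat W i (flip b) a = ∅ := Finset.card_eq_zero.1 (by omega)
    refine not_mem_hat_of_disjoint hdisj a pmem (mem_of_cover (code _) (notwin _)
      (fun x hx => exists_of_cnt_pos ?_) (by omega))
    have e := r4 x
    rw [hp, hp', hD, cnt_singleton, cnt_singleton, ind_of_mem hx, cnt, cnt,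
      Finset.sum_empty] at e
    rw [cnt]
    have := ind_nonneg p' x
    omega
  · have hC' : hat W i (flip a) a = ∅ := Finset.card_eq_zero.1 (by omega)
    refine not_mem_hat_of_disjoint hdisj a pmem' (mem_of_cover (code _) (notwin _)
      (fun x hx => exists_of_cnt_pos ?_) (by omega))
    have e := r4 x
    rw [hp, hp', hC', cnt_singleton, cnt_singleton, ind_of_mem hx, cnt, cnt,
      Finset.sum_empty] at e
    rw [cnt]
    have := ind_nonneg p x
    omega
  obtain ⟨q, hq⟩ := Finset.card_eq_one.1 hC
  obtain ⟨q', hq'⟩ := Finset.card_eq_one.1 (show (hat W i (flip b) a).card = 1 by omega)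
  have qmem : q ∈ hat W i (flip a) a := by simp [hq]
  have qmem' : q' ∈ hat W i (flip b) a := by simp [hq']
  simp only [hp, hp', hq, hq', cnt_singleton] at r2 r3 r4
  have hpq : q ≠ p := by
    rintro rfl; exact not_mem_hat_of_disjoint hdisj a pmem qmem
  have hpq' : q' ≠ p' := by
    rintro rfl; exact not_mem_hat_of_disjoint hdisj a pmem' qmem'
  obtain ⟨k, hk⟩ := dicho_of_mem_hat hV hfb' hffb' a pmem pmem'
  have hpA : p ∉ hat V i a a := fun h => not_mem_hat_flip hVt a h pmem
  have hqC : q ∉ hat W i a a := fun h => not_mem_hat_flip hWt a h qmem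
  have hpB : p' ∉ hat V i b a := fun h => not_mem_hat_flip hVt a h pmem'
  have hqD : q' ∉ hat W i b a := fun h => not_mem_hat_flip hWt a h qmem'
  by_cases hqp : q = p'
  · have hqp' : q' = p := by
      refine (eq_of_subset fun x hx => mem_of_ind_pos ?_).symm
      have e := r4 x
      rw [hqp, ind_of_mem hx] at e
      omega
    subst hqp hqp'
    have m1 := update_mem_of_exchange (k := k) (code' a) (notwin' a) (code a) (notwin a) (by omega)
      (by omega) hpA hqC hk fun x => by have := r1 x; have := r2 x; have := r3 x; omega
    have m2 := update_mem_of_exchange (k := k) (code b) (notwin b) (code' b) (notwin' b) (by omega)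
      (by omega) hqD hpB hk fun x => by have := r1 x; have := r2 x; have := r3 x; omega
    suffices hup : update q k (q' k) = q' from hpA (hup ▸ m1)
    refine eq_of_subset fun x hx => ?_
    have e := r3 x
    rw [cnt_eq_one (code b) m2 hx, cnt_eq_zero] at e
    · refine mem_of_ind_pos ?_
      have := ind_nonneg q x
      omega
    · intro v hv hxv
      exact not_dicho_of_mem hx hxv (dicho_of_mem_hat hV hba hba' a m1 hv)
  · have cover : ∀ w, w = q ∨ w = q' → ∀ x, Mem x w → Mem x p ∨ Mem x p' := by
      intro w hw x hx
      by_contra! h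
      have e := r4 x
      rw [ind_of_not_mem h.1, ind_of_not_mem h.2] at e
      have := ind_nonneg q x
      have := ind_nonneg q' x
      have : ind w x = 1 := ind_of_mem hx
      rcases hw with rfl | rfl <;> omega
    have hqp' : q' ≠ p := by
      rintro rfl
      refine hqp (eq_of_subset fun x hx => mem_of_ind_pos ?_)
      have e := r4 x
      rw [ind_of_mem hx] at e
      omega
    obtain ⟨j, hj, hqp1, hqp2, hn, hn'⟩ := exists_of_cover_pair (cover q (Or.inl rfl)) hpq hqp
    obtain ⟨j', hj', hqp1', hqp2', -⟩ := exists_of_cover_pair (cover q' (Or.inr rfl)) hqp' hpq'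
    have hjj : j' = j := by
      by_contra hne
      have e1 := congrFun hqp1 j'
      have e2 := congrFun hqp2 j'
      rw [update_of_ne hne] at e1 e2
      rw [← e2, ← e1] at hj'
      exact ne_flip _ hj'
    subst hjj
    obtain ⟨s, hs⟩ := dicho_of_mem_hat hW hfb' hffb' a qmem qmem'
    have hsj : s = j' := by
      by_contra hne
      have e1 := congrFun hqp1 s
      have e2 := congrFun hqp1' s
      rw [update_of_ne hne] at e1 e2
      rw [e1, e2] at hs
      exact ne_flip _ hs
    subst hsj
    have ep : p' = update p s (flip (p s)) := by
      funext t
      by_cases ht : t = s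
      · rw [ht, hj, update_self]
      · have e1 := congrFun hqp1 t
        have e2 := congrFun hqp2 t
        rw [update_of_ne ht] at e1 e2 ⊢
        rw [← e1, ← e2]
    have eq' : q' = update p s (flip (q s)) := by rw [← hs]; exact hqp1'
    refine not_twin_exchange (p := p) (j := s) (m := q s) (code' a) (notwin' a) (code a) (notwin a)
      (by omega) (by omega) (Finset.card_pos.1 (by omega)) hpA (by rwa [← hqp1]) hn
      (by rwa [← hj]) ?_ ?_ ?_
    · intro v hv
      rw [← ep]
      exact dicho_symm (dicho_of_mem_hat hV hfb hfb' a hv pmem')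
    · intro v hv
      rw [← eq']
      exact dicho_symm (dicho_of_mem_hat hW hfb hfb' a hv qmem')
    · intro x
      rw [← ep, ← eq']
      exact r2 x

section Encoding

open Classical in
/-- The letter of the concrete alphabet encoding `s`. -/
noncomputable def encode (c : S → S) (a b s : S) : Letter :=
  (decide (s = b ∨ s = c b), decide (s = a ∨ s = b))

lemma encode_injective_and_comp {c : S → S} (hinv : Function.Involutive c) (hfix : ∀ s, c s ≠ s)
    {a b : S} (hba : b ≠ a) (hba' : b ≠ c a)
    (hS : ∀ s : S, s = a ∨ s = c a ∨ s = b ∨ s = c b) :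
    Injective (encode c a b) ∧ ∀ s, encode c a b (c s) = flip (encode c a b s) := by
  have hab : c b ≠ a := by rintro h; exact hba' (by rw [← h, hinv])
  have hab' : c a ≠ c b := fun h => hba (hinv.injective h).symm
  have e1 : encode c a b a = (false, true) := by simp [encode, hba.symm, hab.symm]
  have e2 : encode c a b (c a) = (false, false) := by
    simp [encode, hba'.symm, hab', hfix]
  have e3 : encode c a b b = (true, true) := by simp [encode]
  have e4 : encode c a b (c b) = (true, false) := by simp [encode, hab, hfix]
  refine ⟨?_, ?_⟩
  · intro s t h
    rcases hS s with rfl | rfl | rfl | rfl <;> rcases hS t with rfl | rfl | rfl | rfl <;>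
      simp_all
  · intro s
    rcases hS s with rfl | rfl | rfl | rfl <;> simp [e1, e2, e3, e4, hinv _, flip]

end Encoding

lemma cnt_eq_cnt {V W : Finset (Fin d → Letter)}
    (hV : PolyboxCode flip (V : Set (Fin d → Letter)))
    (hW : PolyboxCode flip (W : Set (Fin d → Letter)))
    {x : Fin d → Letter} (h : (∃ v ∈ V, Mem x v) ↔ ∃ w ∈ W, Mem x w) : cnt V x = cnt W x := by
  by_cases hx : ∃ v ∈ V, Mem x v
  · obtain ⟨w, hw, hxw⟩ := h.1 hx
    obtain ⟨v, hv, hxv⟩ := hx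
    rw [cnt_eq_one hV hv hxv, cnt_eq_one hW hw hxw]
  · have hx' := mt h.2 hx
    push Not at hx hx'
    rw [cnt_eq_zero hx, cnt_eq_zero hx']

end Polybox

open Polybox

theorem no_5_1_5_1_distribution {d : ℕ} [Fintype S] (c : S → S)
    (hinv : Function.Involutive c) (hfix : ∀ s, c s ≠ s)
    (a b : S) (hba : b ≠ a) (hba' : b ≠ c a)
    (hS : ∀ s : S, s = a ∨ s = c a ∨ s = b ∨ s = c b)
    (V W : Set (Fin d → S))
    (hV : PolyboxCode c V) (hW : PolyboxCode c W)
    (hdisj : Disjoint V W) (heq : EquivCodes c V W)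
    (hVt : NoTwinPair c V) (hWt : NoTwinPair c W)
    (hcard : V.ncard = 12) :
    ¬ ∃ i : Fin d,
        (Subcode V i a).ncard = 5 ∧ (Subcode V i (c a)).ncard = 1 ∧
        (Subcode V i b).ncard = 5 ∧ (Subcode V i (c b)).ncard = 1 := by
  rintro ⟨i, h1, h2, h3, h4⟩
  classical
  obtain ⟨hinj, hcomp⟩ := encode_injective_and_comp hinv hfix hba hba' hS
  set e := encode c a b
  set E : (Fin d → S) → Fin d → Letter := fun v j => e (v j) with hE
  have hEinj : Function.Injective E := fun u v h => funext fun j => hinj (congrFun h j)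
  have hcode : ∀ P : Set (Fin d → S), PolyboxCode c P →
      PolyboxCode Polybox.flip (P.toFinite.toFinset.image E : Set (Fin d → Letter)) := by
    intro P hP u hu v hv huv
    simp only [Finset.coe_image, Set.Finite.coe_toFinset] at hu hv
    obtain ⟨u, hu, rfl⟩ := hu
    obtain ⟨v, hv, rfl⟩ := hv
    obtain ⟨j, hj⟩ := hP u hu v hv (by rintro rfl; exact huv rfl)
    exact ⟨j, by simp only [hE, hj, hcomp]⟩
  have hno : ∀ P : Set (Fin d → S), NoTwinPair c P →
      NoTwinPair Polybox.flip (P.toFinite.toFinset.image E : Set (Fin d → Letter)) := by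
    intro P hP u hu v hv huv
    simp only [Finset.coe_image, Set.Finite.coe_toFinset] at hu hv
    obtain ⟨u, hu, rfl⟩ := hu
    obtain ⟨v, hv, rfl⟩ := hv
    obtain ⟨j, hj, h⟩ := huv
    refine hP u hu v hv ⟨j, hinj ?_, fun k hk => hinj (h k hk)⟩
    rw [hcomp]; exact hj
  have hmem : ∀ (P : Set (Fin d → S)) (x : Fin d → Letter),
      (∃ v ∈ P.toFinite.toFinset.image E, Mem x v) ↔
        (fun j => {s | Has (x j) (e s)}) ∈ RealizeSet c P := by
    intro P x
    have hES : ∀ z, {s | Has z (e s)} ∈ ESet c := by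
      intro z s
      simp only [Set.mem_ofPred_eq, hcomp, has_flip]
      by_cases h : Has z (e s)
      · exact Or.inl ⟨h, not_not.2 h⟩
      · exact Or.inr ⟨h, h⟩
    simp only [Finset.mem_image, Set.Finite.mem_toFinset, RealizeSet, Set.mem_iUnion, exists_prop]
    constructor
    · rintro ⟨_, ⟨v, hv, rfl⟩, hx⟩
      exact ⟨v, hv, fun j => ⟨hES _, hx j⟩⟩
    · rintro ⟨v, hv, hx⟩
      exact ⟨_, ⟨v, hv, rfl⟩, fun j => (hx j).2⟩
  have hcount : ∀ s, ((V.toFinite.toFinset.image E).filter (· i = e s)).card =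
      (Subcode V i s).ncard := by
    intro s
    rw [← Set.ncard_coe_finset, ← Set.ncard_image_of_injective (Subcode V i s) hEinj]
    congr 1
    ext w
    simp only [Finset.coe_filter, Finset.mem_image, Set.Finite.mem_toFinset, Set.mem_ofPred_eq,
      Set.mem_image, Subcode]
    constructor
    · rintro ⟨⟨v, hv, rfl⟩, h⟩
      exact ⟨v, ⟨hv, hinj h⟩, rfl⟩
    · rintro ⟨v, ⟨hv, h⟩, rfl⟩
      exact ⟨⟨v, hv, rfl⟩, by simp only [hE, h]⟩
  refine no_distribution (hcode V hV) (hcode W hW) ?_ (fun x => cnt_eq_cnt (hcode V hV)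
    (hcode W hW) ?_) (hno V hVt) (hno W hWt) i (a := e a) (b := e b) (hinj.ne hba)
    (by rw [← hcomp]; exact hinj.ne hba') (by rw [hcount, h1]) (by rw [← hcomp, hcount, h2])
    (by rw [hcount, h3]) (by rw [← hcomp, hcount, h4])
  · rw [Finset.disjoint_image hEinj]
    simpa using hdisj
  · rw [hmem, hmem, heq]
end

section
/- Let S be a finite alphabet with a complementation and let V, W ⊆ S^d be disjoint equivalent polybox codes without twin pairs. Suppose there exist i ∈ {1,…,d} and l, s ∈ S with s ∉ {l, l'} such that either (|V^{i,l}| = |V^{i,l'}| = 1 and |V^{i,s}| ≠ |V^{i,s'}|) or (|V^{i,l}| = 1 and 2 ≤ |V^{i,l'}| ≤ 4). Then |V| > 12. -/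
variable {S : Type}

/-! ### Transversals and flips -/

/-- A point of `(ES)^d`. -/
def ValidPoint {d : ℕ} (c : S → S) (x : Fin d → Set S) : Prop := ∀ j, x j ∈ ESet c

/-- The point `x` lies in the box of the word `v`, provided `x` is valid. -/
def InBox {d : ℕ} (v : Fin d → S) (x : Fin d → Set S) : Prop := ∀ j, v j ∈ x j

/-- Exchange the letters `a` and `c a` in a transversal. -/
def swapLetter (c : S → S) (a : S) (B : Set S) : Set S :=
  {s | ((s = a ∨ s = c a) ∧ s ∉ B) ∨ (s ≠ a ∧ s ≠ c a ∧ s ∈ B)}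

/-- Complement a transversal except at the pair `a`, `c a`. -/
def flipKeep (c : S → S) (a : S) (B : Set S) : Set S := (swapLetter c a B)ᶜ

section Basics

variable {c : S → S} {B : Set S} {a b s : S}

theorem mem_eSet_iff : B ∈ ESet c ↔ ∀ s, s ∈ B ↔ c s ∉ B :=
  forall_congr' fun _ => xor_iff_iff_not

theorem mem_iff_compl_notMem (hB : B ∈ ESet c) (s : S) : s ∈ B ↔ c s ∉ B :=
  mem_eSet_iff.mp hB s

theorem compl_mem_eSet (hB : B ∈ ESet c) : Bᶜ ∈ ESet c :=
  mem_eSet_iff.mpr fun s => not_congr (mem_iff_compl_notMem hB s)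

theorem mem_swapLetter_of_ne (h1 : s ≠ a) (h2 : s ≠ c a) : s ∈ swapLetter c a B ↔ s ∈ B := by
  simp [swapLetter, h1, h2]

theorem mem_swapLetter_self : a ∈ swapLetter c a B ↔ a ∉ B := by
  simp [swapLetter]

theorem mem_swapLetter_compl : c a ∈ swapLetter c a B ↔ c a ∉ B := by
  simp [swapLetter]

theorem swapLetter_mem_eSet (hinv : Function.Involutive c) (hB : B ∈ ESet c) (a : S) :
    swapLetter c a B ∈ ESet c := by
  refine mem_eSet_iff.mpr fun s => ?_
  have h := mem_iff_compl_notMem hB s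
  by_cases h1 : s = a
  · subst h1
    rw [mem_swapLetter_self, mem_swapLetter_compl, h]
  by_cases h2 : s = c a
  · subst h2
    rw [hinv a] at h ⊢
    rw [mem_swapLetter_self, mem_swapLetter_compl, h]
  have h3 : c s ≠ a := fun h => h2 (by rw [← h, hinv s])
  have h4 : c s ≠ c a := fun h => h1 (hinv.injective h)
  rwa [mem_swapLetter_of_ne h1 h2, mem_swapLetter_of_ne h3 h4]

theorem flipKeep_mem_eSet (hinv : Function.Involutive c) (hB : B ∈ ESet c) (a : S) :
    flipKeep c a B ∈ ESet c :=
  compl_mem_eSet (swapLetter_mem_eSet hinv hB a)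

theorem mem_flipKeep_self : a ∈ flipKeep c a B ↔ a ∈ B := by
  simp [flipKeep, mem_swapLetter_self]

theorem mem_flipKeep_of_ne (h1 : s ≠ a) (h2 : s ≠ c a) : s ∈ flipKeep c a B ↔ s ∉ B := by
  simp [flipKeep, mem_swapLetter_of_ne h1 h2]

theorem exists_eSet_mem [Fintype S] (hinv : Function.Involutive c) (hfix : ∀ s, c s ≠ s) (s : S) :
    ∃ B ∈ ESet c, s ∈ B := by
  obtain ⟨f⟩ : Nonempty (S ≃ Fin (Fintype.card S)) := ⟨Fintype.equivFin S⟩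
  have hB : {s | f s < f (c s)} ∈ ESet c := by
    refine mem_eSet_iff.mpr fun s => ?_
    have h : f s ≠ f (c s) := fun h => hfix s (f.injective h).symm
    simp only [Set.mem_ofPred_eq, hinv s, not_lt]
    exact ⟨le_of_lt, fun h1 => lt_of_le_of_ne h1 h⟩
  by_cases hs : s ∈ {s | f s < f (c s)}
  · exact ⟨_, hB, hs⟩
  · exact ⟨_, compl_mem_eSet hB, hs⟩

end Basics

section Points

variable {d : ℕ} {c : S → S} {x y : Fin d → Set S} {u v w : Fin d → S}

theorem ValidPoint.update (hx : ValidPoint c x) (j : Fin d) {B : Set S} (hB : B ∈ ESet c) :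
    ValidPoint c (Function.update x j B) := by
  intro k
  by_cases h : k = j
  · subst h; simpa using hB
  · simpa [h] using hx k

theorem inBox_update {j : Fin d} {B : Set S} :
    InBox v (Function.update x j B) ↔ v j ∈ B ∧ ∀ k, k ≠ j → v k ∈ x k := by
  constructor
  · intro h
    refine ⟨by simpa using h j, fun k hk => by simpa [hk] using h k⟩
  · rintro ⟨h1, h2⟩ k
    by_cases h : k = j
    · subst h; simpa using h1
    · simpa [h] using h2 k h

theorem mem_realize_iff : x ∈ Realize c v ↔ ValidPoint c x ∧ InBox v x := by
  simp only [Realize, ELetter, ValidPoint, InBox, Set.mem_ofPred_eq]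
  exact forall_and

theorem EquivCodes.covers {V W : Set (Fin d → S)} (h : EquivCodes c V W) (hx : ValidPoint c x) :
    (∃ v ∈ V, InBox v x) ↔ ∃ w ∈ W, InBox w x := by
  have := Set.ext_iff.mp h x
  simpa [RealizeSet, mem_realize_iff, hx] using this

theorem ne_compl_of_mem {B : Set S} (hB : B ∈ ESet c) {a b : S} (ha : a ∈ B) (hb : b ∈ B) :
    b ≠ c a := by
  rintro rfl
  exact (mem_iff_compl_notMem hB a).mp ha hb

theorem PolyboxCode.eq_of_inBox {V : Set (Fin d → S)} (hV : PolyboxCode c V)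
    (hx : ValidPoint c x) (hu : u ∈ V) (hv : v ∈ V) (hux : InBox u x) (hvx : InBox v x) :
    u = v := by
  by_contra hne
  obtain ⟨j, hj⟩ := hV u hu v hv hne
  exact ne_compl_of_mem (hx j) (hux j) (hvx j) hj

/-- If `u`, `v` are distinct words of a code and there is a transversal containing both letters
at every position other than `j`, then they are dichotomous at `j`. -/
theorem PolyboxCode.eq_compl_of_mem {V : Set (Fin d → S)} (hV : PolyboxCode c V)
    (hx : ValidPoint c x) (hu : u ∈ V) (hv : v ∈ V) (hne : u ≠ v) {j : Fin d}
    (hux : ∀ k, k ≠ j → u k ∈ x k) (hvx : ∀ k, k ≠ j → v k ∈ x k) : v j = c (u j) := by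
  obtain ⟨k, hk⟩ := hV u hu v hv hne
  by_cases h : k = j
  · rwa [h] at hk
  · exact absurd hk (ne_compl_of_mem (hx k) (hux k h) (hvx k h))

theorem PolyboxCode.mono {V W : Set (Fin d → S)} (hV : PolyboxCode c V) (h : W ⊆ V) :
    PolyboxCode c W :=
  fun u hu v hv => hV u (h hu) v (h hv)

theorem NoTwinPair.mono {V W : Set (Fin d → S)} (hV : NoTwinPair c V) (h : W ⊆ V) : NoTwinPair c W :=
  fun u hu v hv => hV u (h hu) v (h hv)

theorem twinPair_update (j : Fin d) (w : Fin d → S) :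
    TwinPair c w (Function.update w j (c (w j))) :=
  ⟨j, by simp, fun i hi => by simp [hi]⟩

end Points

/-! ### Covers of a word by a twin-free code -/

section Cover

variable {d : ℕ} {c : S → S}

/-- A nonempty part of the box of `p` which is covered by a twin-free code not containing `p`, and
which is closed under flips at the positions where the covering word differs from `p`, needs at
least five covering words. -/
theorem five_le_card_of_flip_closed (hinv : Function.Involutive c)
    {X : Finset (Fin d → S)} (hX : PolyboxCode c (X : Set (Fin d → S)))
    (htw : NoTwinPair c (X : Set (Fin d → S))) {p : Fin d → S} (hp : p ∉ X)
    {P : Set (Fin d → Set S)} (hne : P.Nonempty)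
    (hval : ∀ y ∈ P, ValidPoint c y) (hbox : ∀ y ∈ P, InBox p y)
    (hcov : ∀ y ∈ P, ∃ w ∈ X, InBox w y)
    (hcl : ∀ y ∈ P, ∀ w ∈ X, InBox w y → ∀ j, w j ≠ p j →
      Function.update y j (flipKeep c (p j) (y j)) ∈ P) :
    5 ≤ X.card := by
  classical
  by_contra hlt
  let J : (Fin d → S) → Finset (Fin d) := fun w => Finset.univ.filter fun j => w j ≠ p j
  have hJ : ∀ w j, j ∈ J w ↔ w j ≠ p j := fun w j => by simp [J]
  obtain ⟨y₀, hy₀⟩ := hne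
  obtain ⟨w₀, hw₀, hwy₀⟩ := hcov y₀ hy₀
  obtain ⟨w, hwmem, hmax⟩ := (X.filter fun w => ∃ y ∈ P, InBox w y).exists_max_image
    (fun w => (J w).card) ⟨w₀, by simpa using ⟨hw₀, y₀, hy₀, hwy₀⟩⟩
  obtain ⟨hw, y, hy, hwy⟩ := Finset.mem_filter.mp hwmem
  have hmax' : ∀ u ∈ X, ∀ z ∈ P, InBox u z → (J u).card ≤ (J w).card := fun u hu z hz huz =>
    hmax u (Finset.mem_filter.mpr ⟨hu, z, hz, huz⟩)
  have hflip : ∀ z ∈ P, ∀ j (s : S), s ∈ z j → s ≠ p j → s ∉ flipKeep c (p j) (z j) := by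
    intro z hz j s hs hsp
    rw [mem_flipKeep_of_ne hsp (ne_compl_of_mem (hval z hz j) (hbox z hz j) hs)]
    simpa using hs
  have hpart : ∀ j, ∃ u, j ∈ J w → u ∈ X ∧ (∀ k, k ≠ j → u k ∈ y k) ∧ u j = c (w j) ∧
      InBox u (Function.update y j (flipKeep c (p j) (y j))) := by
    intro j
    by_cases hj : j ∈ J w
    · rw [hJ] at hj
      obtain ⟨u, hu, huy⟩ := hcov _ (hcl y hy w hw hwy j hj)
      have h := inBox_update.mp huy
      refine ⟨u, fun _ => ⟨hu, h.2, ?_, huy⟩⟩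
      refine hX.eq_compl_of_mem (hval y hy) hw hu ?_ (fun k _ => hwy k) h.2
      rintro rfl
      exact hflip y hy j _ (hwy j) hj h.1
    · exact ⟨w, fun h => absurd h hj⟩
  choose f hf using hpart
  have hfne : ∀ j ∈ J w, f j ≠ w := by
    intro j hj h
    have h1 := (hf j hj).2.2.1
    rw [h] at h1
    exact ne_compl_of_mem (hval y hy j) (hwy j) (hwy j) h1
  have hfinj : ∀ j ∈ J w, ∀ k ∈ J w, j ≠ k → f j ≠ f k := by
    intro j hj k hk hjk h
    have h1 := (hf j hj).2.2.1
    have h2 := (hf k hk).2.1 j hjk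
    rw [← h, h1] at h2
    exact ne_compl_of_mem (hval y hy j) (hwy j) h2 rfl
  have hdich : ∀ j ∈ J w, ∀ k ∈ J w, j ≠ k → f k j = w j ∨ f j k = w k := by
    intro j hj k hk hjk
    obtain ⟨m, hm⟩ := hX _ (hf j hj).1 _ (hf k hk).1 (hfinj j hj k hk hjk)
    by_cases hmj : m = j
    · subst hmj
      rw [(hf m hj).2.2.1, hinv] at hm
      exact Or.inl hm
    by_cases hmk : m = k
    · subst hmk
      rw [(hf m hk).2.2.1] at hm
      exact Or.inr (hinv.injective hm).symm
    · exact absurd hm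
        (ne_compl_of_mem (hval y hy m) ((hf j hj).2.1 m hmj) ((hf k hk).2.1 m hmk))
  have hdiff : ∀ j ∈ J w, ∃ k ∈ J w, k ≠ j ∧ f j k ≠ w k := by
    intro j hj
    by_contra! hall
    have hsub : J w ⊆ J (f j) := by
      intro k hk
      rw [hJ]
      by_cases hkj : k = j
      · subst hkj
        rw [(hf k hk).2.2.1]
        exact (ne_compl_of_mem (hval y hy k) (hwy k) (hbox y hy k)).symm
      · rw [hall k hk hkj]
        exact (hJ w k).mp hk
    have heq : J w = J (f j) := Finset.eq_of_subset_of_card_le hsub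
      (hmax' _ (hf j hj).1 _ (hcl y hy w hw hwy j ((hJ w j).mp hj)) (hf j hj).2.2.2)
    refine htw w hw (f j) (hf j hj).1 ⟨j, (hf j hj).2.2.1, fun k hkj => ?_⟩
    by_cases hk : k ∈ J w
    · exact hall k hk hkj
    · have h1 : k ∉ J (f j) := heq ▸ hk
      rw [hJ, not_not] at hk h1
      rw [hk, h1]
  have hins : insert w ((J w).image f) ⊆ X := by
    intro u hu
    rcases Finset.mem_insert.mp hu with rfl | hu
    · exact hw
    · obtain ⟨j, hj, rfl⟩ := Finset.mem_image.mp hu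
      exact (hf j hj).1
  have hcard : (insert w ((J w).image f)).card = (J w).card + 1 := by
    rw [Finset.card_insert_of_notMem, Finset.card_image_of_injOn]
    · intro j hj k hk h
      by_contra hjk
      exact hfinj j hj k hk hjk h
    · intro h
      obtain ⟨j, hj, h⟩ := Finset.mem_image.mp h
      exact hfne j hj h
  have hle := Finset.card_le_card hins
  -- the only possible cyclic configuration leaves a point uncovered
  have hcyc : ∀ j₁ j₂ j₃ : Fin d, j₁ ≠ j₂ → j₁ ≠ j₃ → j₂ ≠ j₃ → J w = {j₁, j₂, j₃} →
      f j₁ j₂ = w j₂ → f j₂ j₃ = w j₃ → f j₃ j₁ = w j₁ → False := by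
    intro j₁ j₂ j₃ h12 h13 h23 hJw e12 e23 e31
    have hcJ : (J w).card = 3 := Finset.card_eq_three.mpr ⟨_, _, _, h12, h13, h23, hJw⟩
    have hXeq : insert w ((J w).image f) = X :=
      Finset.eq_of_subset_of_card_le hins (by omega)
    have hm1 : j₁ ∈ J w := by simp [hJw]
    have hm2 : j₂ ∈ J w := by simp [hJw]
    have hm3 : j₃ ∈ J w := by simp [hJw]
    have hXc : ∀ u ∈ X, u = w ∨ u = f j₁ ∨ u = f j₂ ∨ u = f j₃ := by
      intro u hu
      rw [← hXeq, hJw] at hu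
      simpa using hu
    have hn1 : w j₁ ∉ flipKeep c (p j₁) (y j₁) := hflip y hy j₁ _ (hwy j₁) ((hJ _ _).mp hm1)
    have hn2 : w j₂ ∉ flipKeep c (p j₂) (y j₂) := hflip y hy j₂ _ (hwy j₂) ((hJ _ _).mp hm2)
    have hn3 : w j₃ ∉ flipKeep c (p j₃) (y j₃) := hflip y hy j₃ _ (hwy j₃) ((hJ _ _).mp hm3)
    have hy1 := hcl y hy w hw hwy j₁ ((hJ _ _).mp hm1)
    have hy2 := hcl _ hy1 (f j₁) (hf j₁ hm1).1 (hf j₁ hm1).2.2.2 j₂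
      (by rw [e12]; exact (hJ _ _).mp hm2)
    rw [Function.update_of_ne h12.symm] at hy2
    obtain ⟨u, hu, huy⟩ := hcov _ hy2
    have hu1 := huy j₁
    have hu2 := huy j₂
    rw [Function.update_of_ne h12, Function.update_self] at hu1
    rw [Function.update_self] at hu2
    have huf : u = f j₂ := by
      rcases hXc u hu with rfl | rfl | rfl | rfl
      · exact absurd hu1 hn1
      · rw [e12] at hu2
        exact absurd hu2 hn2
      · rfl
      · rw [e31] at hu1
        exact absurd hu1 hn1
    subst huf
    have hy3 := hcl _ hy2 (f j₂) hu huy j₃ (by rw [e23]; exact (hJ _ _).mp hm3)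
    rw [Function.update_of_ne h23.symm, Function.update_of_ne h13.symm] at hy3
    obtain ⟨v, hv, hvy⟩ := hcov _ hy3
    have hv1 := hvy j₁
    have hv2 := hvy j₂
    have hv3 := hvy j₃
    rw [Function.update_of_ne h13, Function.update_of_ne h12, Function.update_self] at hv1
    rw [Function.update_of_ne h23, Function.update_self] at hv2
    rw [Function.update_self] at hv3
    rcases hXc v hv with rfl | rfl | rfl | rfl
    · exact hn1 hv1
    · rw [e12] at hv2
      exact hn2 hv2
    · rw [e23] at hv3
      exact hn3 hv3
    · rw [e31] at hv1
      exact hn1 hv1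
  have h4 : (J w).card = 0 ∨ (J w).card = 1 ∨ (J w).card = 2 ∨ (J w).card = 3 := by omega
  rcases h4 with h | h | h | h
  · apply hp
    have : w = p := by
      funext j
      by_contra hj
      rw [Finset.card_eq_zero] at h
      have := (hJ w j).mpr hj
      simp [h] at this
    rwa [← this]
  · obtain ⟨j, hj⟩ := Finset.card_eq_one.mp h
    obtain ⟨k, hk, hkj, -⟩ := hdiff j (by simp [hj])
    rw [hj, Finset.mem_singleton] at hk
    exact hkj hk
  · obtain ⟨j, k, hjk, he⟩ := Finset.card_eq_two.mp h
    have hj : j ∈ J w := by simp [he]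
    have hk : k ∈ J w := by simp [he]
    have h1 : f j k ≠ w k := by
      obtain ⟨m, hm, hmj, hne⟩ := hdiff j hj
      simp only [he, Finset.mem_insert, Finset.mem_singleton] at hm
      grind
    have h2 : f k j ≠ w j := by
      obtain ⟨m, hm, hmj, hne⟩ := hdiff k hk
      simp only [he, Finset.mem_insert, Finset.mem_singleton] at hm
      grind
    rcases hdich j hj k hk hjk with h | h
    · exact h2 h
    · exact h1 h
  · obtain ⟨j, k, m, hjk, hjm, hkm, he⟩ := Finset.card_eq_three.mp h
    have hj : j ∈ J w := by simp [he]
    have hk : k ∈ J w := by simp [he]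
    have hm : m ∈ J w := by simp [he]
    have hd1 : f j k ≠ w k ∨ f j m ≠ w m := by
      obtain ⟨n, hn, hnj, hne⟩ := hdiff j hj
      simp only [he, Finset.mem_insert, Finset.mem_singleton] at hn
      grind
    have hd2 : f k j ≠ w j ∨ f k m ≠ w m := by
      obtain ⟨n, hn, hnj, hne⟩ := hdiff k hk
      simp only [he, Finset.mem_insert, Finset.mem_singleton] at hn
      grind
    have hd3 : f m j ≠ w j ∨ f m k ≠ w k := by
      obtain ⟨n, hn, hnj, hne⟩ := hdiff m hm
      simp only [he, Finset.mem_insert, Finset.mem_singleton] at hn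
      grind
    have d1 := hdich j hj k hk hjk
    have d2 := hdich j hj m hm hjm
    have d3 := hdich k hk m hm hkm
    by_cases hc : f j m = w m
    · have e1 := d1.resolve_right (hd1.resolve_right (not_not.mpr hc))
      have e2 := d3.resolve_right (hd2.resolve_left (not_not.mpr e1))
      exact hcyc j m k hjm hjk hkm.symm (by rw [he, Finset.pair_comm]) hc e2 e1
    · have e1 := d2.resolve_right hc
      have e2 := d3.resolve_left (hd3.resolve_left (not_not.mpr e1))
      exact hcyc j k m hjk hjm hkm he (d1.resolve_left (hd2.resolve_right (not_not.mpr e2))) e2 e1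

/-- A word covered by a twin-free code not containing it needs at least five covering words. The
section of the box at a fixed transversal `B` in position `i` suffices. -/
theorem five_le_ncard_of_cover [Fintype S] (hinv : Function.Involutive c) (hfix : ∀ s, c s ≠ s)
    {X : Set (Fin d → S)} (hX : PolyboxCode c X) (htw : NoTwinPair c X) {g : Fin d → S}
    (hg : g ∉ X) {i : Fin d} {B : Set S} (hB : B ∈ ESet c) (hgB : g i ∈ B)
    (hXi : ∀ w ∈ X, w i = g i)
    (hcov : ∀ y, ValidPoint c y → y i = B → InBox g y → ∃ w ∈ X, InBox w y) :
    5 ≤ X.ncard := by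
  classical
  lift X to Finset (Fin d → S) using X.toFinite
  rw [Set.ncard_coe_finset]
  choose T hT using fun s => exists_eSet_mem hinv hfix s
  refine five_le_card_of_flip_closed hinv hX htw (p := g) (by simpa using hg)
    (P := {y | ValidPoint c y ∧ y i = B ∧ InBox g y}) ?_ (fun y hy => hy.1) (fun y hy => hy.2.2)
    (fun y hy => by simpa using hcov y hy.1 hy.2.1 hy.2.2) ?_
  · refine ⟨Function.update (fun j => T (g j)) i B, ?_, by simp, ?_⟩
    · exact ValidPoint.update (fun j => (hT (g j)).1) i hB
    · exact inBox_update.mpr ⟨hgB, fun k _ => (hT (g k)).2⟩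
  · rintro y ⟨hy, hyi, hgy⟩ w hw - j hj
    have hji : i ≠ j := by
      rintro rfl
      exact hj (hXi w (by simpa using hw))
    refine ⟨hy.update j (flipKeep_mem_eSet hinv (hy j) _), by simpa [hji] using hyi, ?_⟩
    exact inBox_update.mpr ⟨mem_flipKeep_self.mpr (hgy j), fun k _ => hgy k⟩

end Cover

/-! ### Counting words by transversals -/

section Counting

variable {d : ℕ} [Fintype S] {c : S → S} {V W : Set (Fin d → S)} {i : Fin d} {B : Set S}

theorem two_mul_ncard_eLetter (a : S) : (ELetter c a).ncard * 2 = (ESet c).ncard := by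
  have h : ESet c = ELetter c a ∪ compl '' ELetter c a := by
    ext B
    constructor
    · intro hB
      by_cases ha : a ∈ B
      · exact Or.inl ⟨hB, ha⟩
      · exact Or.inr ⟨Bᶜ, ⟨compl_mem_eSet hB, ha⟩, compl_compl B⟩
    · rintro (h | ⟨D, h, rfl⟩)
      · exact h.1
      · exact compl_mem_eSet h.1
  have hd : Disjoint (ELetter c a) (compl '' ELetter c a) := by
    rw [Set.disjoint_left]
    rintro _ h ⟨D, hD, rfl⟩
    exact h.2 hD.2
  rw [h, Set.ncard_union_eq hd, Set.ncard_image_of_injective _ compl_injective, mul_two]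

theorem ncard_covered_section (hV : PolyboxCode c V) (hB : B ∈ ESet c) :
    {y | ValidPoint c y ∧ y i = B ∧ ∃ v ∈ V, InBox v y}.ncard =
      {v | v ∈ V ∧ v i ∈ B}.ncard * ∏ j : Fin d, if j = i then 1 else (ESet c).ncard / 2 := by
  classical
  let box : (Fin d → S) → Finset (Fin d → Set S) := fun v =>
    Fintype.piFinset fun j => if j = i then {B} else (ELetter c (v j)).toFinite.toFinset
  have hbox : ∀ v y, v i ∈ B → (y ∈ box v ↔ ValidPoint c y ∧ y i = B ∧ InBox v y) := by
    intro v y hv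
    rw [Fintype.mem_piFinset]
    constructor
    · intro h
      have hi : y i = B := by simpa using h i
      have hj : ∀ j, y j ∈ ESet c ∧ v j ∈ y j := by
        intro j
        by_cases hji : j = i
        · subst hji
          rw [hi]
          exact ⟨hB, hv⟩
        · simpa [hji, ELetter] using h j
      exact ⟨fun j => (hj j).1, hi, fun j => (hj j).2⟩
    · rintro ⟨h1, h2, h3⟩ j
      by_cases hji : j = i
      · subst hji
        simpa using h2
      · simpa [hji, ELetter] using ⟨h1 j, h3 j⟩
  have hcard : ∀ v, (box v).card = ∏ j : Fin d, if j = i then 1 else (ESet c).ncard / 2 := by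
    intro v
    rw [Fintype.card_piFinset]
    refine Finset.prod_congr rfl fun j _ => ?_
    by_cases hji : j = i
    · simp [hji]
    · rw [if_neg hji, if_neg hji, ← Set.ncard_eq_toFinset_card, ← two_mul_ncard_eLetter (v j)]
      omega
  have hunion : {y | ValidPoint c y ∧ y i = B ∧ ∃ v ∈ V, InBox v y} =
      (({v | v ∈ V ∧ v i ∈ B}.toFinite.toFinset.biUnion box : Finset _) : Set _) := by
    ext y
    simp only [Set.mem_ofPred_eq, Finset.coe_biUnion, Set.mem_iUnion, Finset.mem_coe,
      Set.Finite.mem_toFinset, exists_prop]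
    constructor
    · rintro ⟨hy, hyi, v, hv, hvy⟩
      have hvB : v i ∈ B := hyi ▸ hvy i
      exact ⟨v, ⟨hv, hvB⟩, (hbox v y hvB).mpr ⟨hy, hyi, hvy⟩⟩
    · rintro ⟨v, ⟨hv, hvB⟩, h⟩
      obtain ⟨hy, hyi, hvy⟩ := (hbox v y hvB).mp h
      exact ⟨hy, hyi, v, hv, hvy⟩
  rw [hunion, Set.ncard_coe_finset, Finset.card_biUnion]
  · rw [Finset.sum_congr rfl fun v _ => hcard v, Finset.sum_const, smul_eq_mul,
      ← Set.ncard_eq_toFinset_card]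
  · intro u hu v hv huv
    rw [Finset.mem_coe, Set.Finite.mem_toFinset] at hu hv
    change Disjoint (box u) (box v)
    rw [Finset.disjoint_left]
    intro y hyu hyv
    rw [hbox _ _ hu.2] at hyu
    rw [hbox _ _ hv.2] at hyv
    exact huv (hV.eq_of_inBox hyu.1 hu.1 hv.1 hyu.2.2 hyv.2.2)

/-- Equivalent codes have equally many words whose letter at `i` lies in a given transversal. -/
theorem EquivCodes.ncard_eq [Nonempty S] (hinv : Function.Involutive c) (hfix : ∀ s, c s ≠ s)
    (hV : PolyboxCode c V) (hW : PolyboxCode c W) (heq : EquivCodes c V W) (i : Fin d)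
    (hB : B ∈ ESet c) : {v | v ∈ V ∧ v i ∈ B}.ncard = {w | w ∈ W ∧ w i ∈ B}.ncard := by
  have hpos : 0 < ∏ j : Fin d, if j = i then 1 else (ESet c).ncard / 2 := by
    refine Finset.prod_pos fun j _ => ?_
    split_ifs
    · exact one_pos
    · obtain ⟨a⟩ := ‹Nonempty S›
      obtain ⟨D, hD, ha⟩ := exists_eSet_mem hinv hfix a
      have h1 : 0 < (ELetter c a).ncard := (Set.ncard_pos (Set.toFinite _)).mpr ⟨D, hD, ha⟩
      have h2 := two_mul_ncard_eLetter (c := c) a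
      omega
  refine Nat.eq_of_mul_eq_mul_right hpos ?_
  rw [← ncard_covered_section hV hB, ← ncard_covered_section hW hB]
  congr 1
  ext y
  simp only [Set.mem_ofPred_eq]
  exact and_congr_right fun hy => and_congr_right fun _ => heq.covers hy

end Counting

/-! ### The distribution of letters at one position -/

section Distribution

variable {d : ℕ} [Fintype S] {c : S → S} {V W : Set (Fin d → S)} {i : Fin d} {l : S}
  {p : Fin d → S} {B : Set S}

/-- If `p` is the only word of `V` with letter `l` at `i`, and few words of `V` carry the
complementary letter there, then `W` has at least five words with letter `l` at `i`. -/
theorem five_le_ncard_subcode (hinv : Function.Involutive c) (hfix : ∀ s, c s ≠ s)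
    (hV : PolyboxCode c V) (hW : PolyboxCode c W) (hdisj : Disjoint V W) (heq : EquivCodes c V W)
    (hVt : NoTwinPair c V) (hWt : NoTwinPair c W) (hp : Subcode V i l = {p})
    (hQ : (Subcode V i (c l)).ncard ≤ 4) : 5 ≤ (Subcode W i l).ncard := by
  classical
  obtain ⟨hpV, hpi⟩ : p ∈ Subcode V i l := hp ▸ Set.mem_singleton p
  have hpu : ∀ v ∈ V, v i = l → v = p := fun v hv hvi => by
    have h : v ∈ Subcode V i l := ⟨hv, hvi⟩
    rwa [hp] at h
  have hsub : Subcode W i l ⊆ W := fun w hw => hw.1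
  obtain ⟨B, hB, hlB⟩ := exists_eSet_mem hinv hfix l
  have hB' := swapLetter_mem_eSet hinv hB l
  have hlB' : l ∉ swapLetter c l B := fun h => mem_swapLetter_self.mp h hlB
  have hclB : c l ∉ B := (mem_iff_compl_notMem hB l).mp hlB
  have hclB' : c l ∈ swapLetter c l B := mem_swapLetter_compl.mpr hclB
  have hXc := hW.mono hsub
  have hXt := hWt.mono hsub
  have hpX : p ∉ Subcode W i l := fun h => hdisj.ne_of_mem hpV h.1 rfl
  generalize hX : Subcode W i l = X at hXc hXt hpX
  have hXmem : ∀ w, w ∈ X ↔ w ∈ W ∧ w i = l := fun w => by rw [← hX]; exact Iff.rfl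
  lift X to Finset (Fin d → S) using X.toFinite
  rw [Set.ncard_coe_finset]
  refine five_le_card_of_flip_closed hinv hXc hXt (p := p) (by simpa using hpX)
    (P := {y | ValidPoint c y ∧ y i = B ∧ InBox p y ∧
      ∀ q ∈ Subcode V i (c l), ¬ InBox q (Function.update y i (swapLetter c l B))})
    ?_ (fun y hy => hy.1) (fun y hy => hy.2.2.1) ?_ ?_
  · by_contra hempty
    have h5 : 5 ≤ (Subcode V i (c l)).ncard := by
      refine five_le_ncard_of_cover hinv hfix (g := Function.update p i (c l)) (i := i)
        (hV.mono fun v hv => hv.1) (hVt.mono fun v hv => hv.1) ?_ hB' (by simpa using hclB')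
        (fun w hw => by simpa using hw.2) ?_
      · intro h
        have := twinPair_update (c := c) i p
        rw [hpi] at this
        exact hVt p hpV _ h.1 this
      · intro y hy hyi hpy
        by_contra! hno
        refine hempty ⟨Function.update y i B, hy.update i hB, by simp, ?_, ?_⟩
        · refine inBox_update.mpr ⟨hpi ▸ hlB, fun k hk => ?_⟩
          simpa [hk] using hpy k
        · intro q hq
          rw [Function.update_idem, ← hyi, Function.update_eq_self]
          exact hno q hq
    omega
  · rintro y ⟨hy, hyi, hpy, hno⟩
    obtain ⟨w, hw, hwy⟩ := (heq.covers hy).mp ⟨p, hpV, hpy⟩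
    refine ⟨w, ?_, hwy⟩
    by_contra hwX
    have hwl : w i ≠ l := fun h => hwX (Finset.mem_coe.mp ((hXmem w).mpr ⟨hw, h⟩))
    have hwB : w i ∈ B := hyi ▸ hwy i
    have hwc : w i ≠ c l := fun h => hclB (h ▸ hwB)
    have hwB' := (mem_swapLetter_of_ne hwl hwc).mpr hwB
    obtain ⟨v, hv, hvy⟩ := (heq.covers (hy.update i hB')).mpr
      ⟨w, hw, inBox_update.mpr ⟨hwB', fun k _ => hwy k⟩⟩
    have hvi := inBox_update.mp hvy
    have hvl : v i ≠ l := fun h => hlB' (h ▸ hvi.1)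
    have hvc : v i ≠ c l := fun h => hno v ⟨hv, h⟩ hvy
    have hvB : v i ∈ B := (mem_swapLetter_of_ne hvl hvc).mp hvi.1
    have hvb : InBox v y := by
      intro k
      by_cases hk : k = i
      · rw [hk, hyi]; exact hvB
      · exact hvi.2 k hk
    exact hvl ((hV.eq_of_inBox hy hv hpV hvb hpy).symm ▸ hpi)
  · rintro y ⟨hy, hyi, hpy, hno⟩ w hw hwy j hwj
    obtain ⟨hwW, hwi⟩ := (hXmem w).mp hw
    have hij : i ≠ j := by
      rintro rfl
      exact hwj (hwi.trans hpi.symm)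
    have hwc : w j ≠ c (p j) := ne_compl_of_mem (hy j) (hpy j) (hwy j)
    obtain ⟨r, hr, hry⟩ := (heq.covers (hy.update j (swapLetter_mem_eSet hinv (hy j) (p j)))).mpr
      ⟨w, hwW, inBox_update.mpr
        ⟨(mem_swapLetter_of_ne hwj hwc).mpr (hwy j), fun k _ => hwy k⟩⟩
    have hrk := inBox_update.mp hry
    have hrp : r ≠ p := by
      rintro rfl
      exact mem_swapLetter_self.mp hrk.1 (hpy j)
    have hrB : r i ∈ B := hyi ▸ hrk.2 i hij
    have hrj : r j = c (p j) := hV.eq_compl_of_mem hy hpV hr hrp.symm (fun k _ => hpy k) hrk.2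
    refine ⟨hy.update j (flipKeep_mem_eSet hinv (hy j) _), by simpa [hij] using hyi,
      inBox_update.mpr ⟨mem_flipKeep_self.mpr (hpy j), fun k _ => hpy k⟩, ?_⟩
    intro q hq hqy
    obtain ⟨hqi, hqk⟩ := inBox_update.mp hqy
    have hqr : q ≠ r := by
      rintro rfl
      exact hclB (hq.2 ▸ hrB)
    obtain ⟨k, hk⟩ := hV q hq.1 r hr hqr
    have hkj : k = j := by
      by_contra hkj
      by_cases hki : k = i
      · rw [hki, hq.2, hinv] at hk
        exact hrp (hpu r hr hk)
      · have h1 := hqk k hki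
        rw [Function.update_of_ne hkj] at h1
        exact ne_compl_of_mem (hy k) h1 (hrk.2 k hkj) hk
    rw [hkj, hrj] at hk
    refine hno q hq (inBox_update.mpr ⟨hqi, fun m hm => ?_⟩)
    by_cases hmj : m = j
    · rw [hmj, ← hinv.injective hk]
      exact hpy j
    · simpa [hmj] using hqk m hm

/-- Under the same hypotheses, every transversal containing `l` contains the `i`-th letter of at
least five words of `V` other than `p`. -/
theorem five_le_ncard_of_mem_eSet (hinv : Function.Involutive c) (hfix : ∀ s, c s ≠ s)
    (hV : PolyboxCode c V) (hW : PolyboxCode c W) (hdisj : Disjoint V W) (heq : EquivCodes c V W)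
    (hVt : NoTwinPair c V) (hWt : NoTwinPair c W) (hp : Subcode V i l = {p})
    (hQ : (Subcode V i (c l)).ncard ≤ 4) (hB : B ∈ ESet c) (hlB : l ∈ B) :
    5 ≤ {v | v ∈ V ∧ v i ∈ B ∧ v i ≠ l}.ncard := by
  classical
  have h5 := five_le_ncard_subcode hinv hfix hV hW hdisj heq hVt hWt hp hQ
  have : Nonempty S := ⟨l⟩
  have hsplit : ∀ U : Set (Fin d → S), {u | u ∈ U ∧ u i ∈ B}.ncard =
      (Subcode U i l).ncard + {u | u ∈ U ∧ u i ∈ B ∧ u i ≠ l}.ncard := by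
    intro U
    rw [← Set.ncard_union_eq]
    · congr 1
      ext u
      simp only [Set.mem_ofPred_eq, Set.mem_union, Subcode]
      by_cases hu : u i = l
      · simp [hu, hlB]
      · simp [hu]
    · rw [Set.disjoint_left]
      rintro u hu hu'
      exact hu'.2.2 hu.2
  have hcount := heq.ncard_eq hinv hfix hV hW i hB
  rw [hsplit, hsplit, hp, Set.ncard_singleton] at hcount
  by_contra hlt
  have hWl : (Subcode W i l).ncard = 5 := by omega
  have hW0 : {u | u ∈ W ∧ u i ∈ B ∧ u i ≠ l} = ∅ := by
    rw [← Set.ncard_eq_zero]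
    omega
  obtain ⟨hpV, hpi⟩ : p ∈ Subcode V i l := hp ▸ Set.mem_singleton p
  have hsub : Subcode W i l ⊆ W := fun w hw => hw.1
  have hcovW : ∀ y, ValidPoint c y → y i = B → (∃ v ∈ V, InBox v y) →
      ∃ w ∈ Subcode W i l, InBox w y := by
    intro y hy hyi hv
    obtain ⟨w, hw, hwy⟩ := (heq.covers hy).mp hv
    refine ⟨w, ⟨hw, ?_⟩, hwy⟩
    by_contra hwl
    have : w ∈ {u | u ∈ W ∧ u i ∈ B ∧ u i ≠ l} := ⟨hw, hyi ▸ hwy i, hwl⟩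
    rw [hW0] at this
    exact this
  have hmeetp : ∀ g ∈ V, g i ∈ B → Function.update g i l ∉ W → ∀ w ∈ Subcode W i l,
      ∃ y, ValidPoint c y ∧ y i = B ∧ InBox w y ∧ InBox g y := by
    intro g hg hgB hgW
    let X : Set (Fin d → S) := {w | w ∈ Subcode W i l ∧
      ∃ y, ValidPoint c y ∧ y i = B ∧ InBox w y ∧ InBox g y}
    have hXs : X ⊆ Subcode W i l := fun w hw => hw.1
    have hX5 : 5 ≤ X.ncard := by
      refine five_le_ncard_of_cover hinv hfix (g := Function.update g i l) (i := i)
        (hW.mono (hXs.trans hsub)) (hWt.mono (hXs.trans hsub)) (fun h => hgW h.1.1) hB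
        (by simpa using hlB) (fun w hw => by simpa using hw.1.2) ?_
      intro y hy hyi hgy
      have hgy' : InBox g y := by
        intro k
        by_cases hk : k = i
        · rw [hk, hyi]; exact hgB
        · simpa [hk] using hgy k
      obtain ⟨w, hw, hwy⟩ := hcovW y hy hyi ⟨g, hg, hgy'⟩
      exact ⟨w, ⟨hw, y, hy, hyi, hwy, hgy'⟩, hwy⟩
    have hXeq : X = Subcode W i l := Set.eq_of_subset_of_ncard_le hXs (by omega)
    intro w hw
    rw [← hXeq] at hw
    exact hw.2
  have hmeet : ∀ g ∈ V, g i ∈ B → ∀ w ∈ Subcode W i l,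
      ∃ y, ValidPoint c y ∧ y i = B ∧ InBox w y ∧ InBox g y := by
    intro g hg hgB
    have hpW : p ∉ W := fun h => hdisj.ne_of_mem hpV h rfl
    refine hmeetp g hg hgB fun hgW => ?_
    obtain ⟨y, hy, hyi, hgy, hpy⟩ := hmeetp p hpV (hpi ▸ hlB)
      (by rwa [← hpi, Function.update_eq_self]) _ ⟨hgW, by simp⟩
    have hgy' : InBox g y := by
      intro k
      by_cases hk : k = i
      · rw [hk, hyi]; exact hgB
      · simpa [hk] using hgy k
    have hgp := hV.eq_of_inBox hy hg hpV hgy' hpy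
    rw [hgp, ← hpi, Function.update_eq_self] at hgW
    exact hpW hgW
  obtain ⟨w, hw, w₂, hw₂, hne⟩ :=
    (Set.one_lt_ncard (Set.toFinite _)).mp (by omega : 1 < (Subcode W i l).ncard)
  obtain ⟨j, hj⟩ := hW w hw.1 w₂ hw₂.1 hne
  have hij : i ≠ j := by
    rintro rfl
    rw [hw.2, hw₂.2] at hj
    exact hfix l hj.symm
  have havoid : ∀ g ∈ V, g i ∈ B → g j ≠ w j ∧ g j ≠ c (w j) := by
    intro g hg hgB
    obtain ⟨y, hy, -, hwy, hgy⟩ := hmeet g hg hgB w hw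
    obtain ⟨z, hz, -, hwz, hgz⟩ := hmeet g hg hgB w₂ hw₂
    refine ⟨fun h => ?_, ne_compl_of_mem (hy j) (hwy j) (hgy j)⟩
    have h1 := ne_compl_of_mem (hz j) (hgz j) (hwz j)
    rw [h] at h1
    exact h1 hj
  have hX5 : 5 ≤ (Subcode W i l \ {w}).ncard := by
    refine five_le_ncard_of_cover hinv hfix (g := Function.update w j (c (w j))) (i := i)
      (hW.mono (Set.sdiff_subset.trans hsub)) (hWt.mono (Set.sdiff_subset.trans hsub))
      (fun h => hWt w hw.1 _ h.1.1 (twinPair_update j w)) hB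
      (by simpa [hij, hw.2] using hlB) (fun u hu => by simpa [hij, hw.2] using hu.1.2) ?_
    intro y hy hyi hty
    have hwj : c (w j) ∈ y j := by simpa using hty j
    have hwj' : w j ∉ y j := fun h => (mem_iff_compl_notMem (hy j) _).mp h hwj
    obtain ⟨g, hg, hgy⟩ := (heq.covers (hy.update j (swapLetter_mem_eSet hinv (hy j) (w j)))).mpr
      ⟨w, hw.1, inBox_update.mpr ⟨mem_swapLetter_self.mpr hwj',
        fun k hk => by simpa [hk] using hty k⟩⟩
    obtain ⟨hg1, hg2⟩ := inBox_update.mp hgy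
    obtain ⟨ha, hb⟩ := havoid g hg (hyi ▸ hg2 i hij)
    have hgy' : InBox g y := by
      intro k
      by_cases hk : k = j
      · subst hk
        exact (mem_swapLetter_of_ne ha hb).mp hg1
      · exact hg2 k hk
    obtain ⟨u, hu, huy⟩ := hcovW y hy hyi ⟨g, hg, hgy'⟩
    refine ⟨u, ⟨hu, ?_⟩, huy⟩
    rintro rfl
    exact hwj' (huy j)
  rw [Set.ncard_sdiff_singleton_of_mem hw, hWl] at hX5
  omega

end Distribution

section Splitting

variable {d : ℕ} [Fintype S] {c : S → S} {i : Fin d} {l t : S} {B : Set S}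

theorem ncard_eq_add_of_mem_eSet (hfix : ∀ s, c s ≠ s) (V : Set (Fin d → S))
    (hB : B ∈ ESet c) (hlB : l ∈ B) :
    V.ncard = (Subcode V i l).ncard + (Subcode V i (c l)).ncard +
      {v | v ∈ V ∧ v i ∈ B ∧ v i ≠ l}.ncard +
      {v | v ∈ V ∧ v i ∈ swapLetter c l Bᶜ ∧ v i ≠ l}.ncard := by
  have hclB : c l ∉ B := (mem_iff_compl_notMem hB l).mp hlB
  have hclB' : c l ∉ swapLetter c l Bᶜ := by
    rw [mem_swapLetter_compl]
    simpa using hclB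
  have hiff : ∀ a, a ≠ l → a ≠ c l → (a ∈ swapLetter c l Bᶜ ↔ a ∉ B) := fun a h1 h2 =>
    mem_swapLetter_of_ne h1 h2
  rw [← Set.ncard_union_eq, ← Set.ncard_union_eq, ← Set.ncard_union_eq]
  · congr 1
    ext v
    simp only [Subcode, Set.mem_union, Set.mem_ofPred_eq]
    by_cases h1 : v i = l
    · simp [h1, (hfix l).symm]
    by_cases h2 : v i = c l
    · simp [h2, hclB, hclB', hfix l]
    have := hiff _ h1 h2
    tauto
  · rw [Set.disjoint_left]
    simp only [Subcode, Set.mem_union, Set.mem_ofPred_eq]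
    rintro v ((⟨-, h⟩ | ⟨-, h⟩) | ⟨-, h, h1⟩) ⟨-, h2, h3⟩
    · exact h3 h
    · exact hclB' (h ▸ h2)
    · exact (hiff _ h1 fun e => hclB (e ▸ h)).mp h2 h
  · rw [Set.disjoint_left]
    simp only [Subcode, Set.mem_union, Set.mem_ofPred_eq]
    rintro v (⟨-, h⟩ | ⟨-, h⟩) ⟨-, h2, h3⟩
    · exact h3 h
    · exact hclB (h ▸ h2)
  · rw [Set.disjoint_left]
    rintro v ⟨-, h⟩ ⟨-, h'⟩
    exact hfix l (h'.symm.trans h)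

theorem ncard_eq_subcode_add (V : Set (Fin d → S)) (ht : t ∈ B) (htl : t ≠ l)
    (hB : B ∈ ESet c) : {v | v ∈ V ∧ v i ∈ B ∧ v i ≠ l}.ncard = (Subcode V i t).ncard +
      {v | v ∈ V ∧ v i ∈ B ∧ v i ≠ l ∧ v i ≠ t ∧ v i ≠ c t}.ncard := by
  rw [← Set.ncard_union_eq]
  · congr 1
    ext v
    simp only [Subcode, Set.mem_union, Set.mem_ofPred_eq]
    by_cases h1 : v i = t
    · simp [h1, ht, htl]
    · have h2 : v i ∈ B → v i ≠ c t := fun h => ne_compl_of_mem hB ht h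
      tauto
  · rw [Set.disjoint_left]
    rintro v h h'
    exact h'.2.2.2.1 h.2

end Splitting

theorem card_gt_twelve_of_special_distribution {d : ℕ} [Fintype S] (c : S → S)
    (hinv : Function.Involutive c) (hfix : ∀ s, c s ≠ s)
    (V W : Set (Fin d → S))
    (hV : PolyboxCode c V) (hW : PolyboxCode c W)
    (hdisj : Disjoint V W) (heq : EquivCodes c V W)
    (hVt : NoTwinPair c V) (hWt : NoTwinPair c W)
    (h : ∃ (i : Fin d) (l s : S), s ≠ l ∧ s ≠ c l ∧
      (((Subcode V i l).ncard = 1 ∧ (Subcode V i (c l)).ncard = 1 ∧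
          (Subcode V i s).ncard ≠ (Subcode V i (c s)).ncard) ∨
        ((Subcode V i l).ncard = 1 ∧ 2 ≤ (Subcode V i (c l)).ncard ∧
          (Subcode V i (c l)).ncard ≤ 4))) :
    12 < V.ncard := by
  obtain ⟨i, l, s, hsl, hscl, h⟩ := h
  have h1 : (Subcode V i l).ncard = 1 := by omega
  have hQ : (Subcode V i (c l)).ncard ≤ 4 := by omega
  obtain ⟨p, hp⟩ := Set.ncard_eq_one.mp h1
  have h5 : ∀ B ∈ ESet c, l ∈ B → 5 ≤ {v | v ∈ V ∧ v i ∈ B ∧ v i ≠ l}.ncard := fun B hB hlB =>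
    five_le_ncard_of_mem_eSet hinv hfix hV hW hdisj heq hVt hWt hp hQ hB hlB
  have hswap : ∀ B ∈ ESet c, l ∈ B → 5 ≤ {v | v ∈ V ∧ v i ∈ swapLetter c l Bᶜ ∧ v i ≠ l}.ncard :=
    fun B hB hlB => h5 _ (swapLetter_mem_eSet hinv (compl_mem_eSet hB) l)
      (mem_swapLetter_self.mpr (not_not.mpr hlB))
  have hls : l ≠ c s := fun h => hscl (by rw [h, hinv])
  obtain ⟨B, hB, hlB, hsB⟩ : ∃ B ∈ ESet c, l ∈ B ∧ s ∈ B := by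
    obtain ⟨B, hB, hlB⟩ := exists_eSet_mem hinv hfix l
    by_cases hsB : s ∈ B
    · exact ⟨B, hB, hlB, hsB⟩
    · exact ⟨_, swapLetter_mem_eSet hinv hB s, (mem_swapLetter_of_ne hsl.symm hls).mpr hlB,
        mem_swapLetter_self.mpr hsB⟩
  have hD := swapLetter_mem_eSet hinv hB s
  have hlD : l ∈ swapLetter c s B := (mem_swapLetter_of_ne hsl.symm hls).mpr hlB
  have hsD : c s ∈ swapLetter c s B :=
    mem_swapLetter_compl.mpr ((mem_iff_compl_notMem hB s).mp hsB)
  have eB := ncard_eq_add_of_mem_eSet (i := i) hfix V hB hlB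
  have eD := ncard_eq_add_of_mem_eSet (i := i) hfix V hD hlD
  have rB := ncard_eq_subcode_add (i := i) V hsB hsl hB
  have rD := ncard_eq_subcode_add (i := i) V hsD hls.symm hD
  have hrest : {v | v ∈ V ∧ v i ∈ swapLetter c s B ∧ v i ≠ l ∧ v i ≠ c s ∧ v i ≠ c (c s)} =
      {v | v ∈ V ∧ v i ∈ B ∧ v i ≠ l ∧ v i ≠ s ∧ v i ≠ c s} := by
    ext v
    simp only [Set.mem_ofPred_eq, hinv s]
    by_cases ha : v i = s
    · simp [ha]
    by_cases hb : v i = c s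
    · simp [hb]
    rw [mem_swapLetter_of_ne ha hb, and_comm (a := v i ≠ c s)]
  rw [hrest] at rD
  have b1 := h5 B hB hlB
  have b2 := hswap B hB hlB
  have b3 := h5 _ hD hlD
  have b4 := hswap _ hD hlD
  omega
end
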